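/- arXiv:1106.0632 — 3 statements merged into one kernel-verified Lean document; each statement's English description precedes it below -/
import Mathlib

section
/- Let n > 0 and let Q be a Schwartz function on ℂ ≅ ℝ². Then the function z₀ ↦ (2n/π) ∫_ℂ e^{inR(z,z₀)} Q(z) dm(z) has Fourier transform ξ ↦ e^{−i(ξ² + ξ̄²)/(16n)} Q̂(ξ). -/
open Complex MeasureTheory

open Filter Topology FourierTransform SchwartzMap

theorem hasTemperateGrowth_cexp_ofReal_mul_I :
    Function.HasTemperateGrowth (fun t : ℝ ↦ cexp (t * I)) := by
  have hd : ∀ k : ℕ, iteratedDeriv k (fun t : ℝ ↦ cexp (t * I)) =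
      fun t : ℝ ↦ I ^ k * cexp (t * I) := by
    intro k
    induction k with
    | zero => simp
    | succ k ih =>
      rw [iteratedDeriv_succ, ih]
      funext t
      have h : HasDerivAt (fun t : ℝ ↦ cexp (t * I)) (cexp (t * I) * (1 * I)) t :=
        ((hasDerivAt_id t).ofReal_comp.mul_const I).cexp
      rw [(h.const_mul (I ^ k)).deriv]
      ring
  refine ⟨(ofRealCLM.contDiff.mul contDiff_const).cexp, fun k ↦ ⟨0, 1, fun t ↦ ?_⟩⟩
  rw [norm_iteratedFDeriv_eq_norm_iteratedDeriv, hd]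
  simp [norm_exp_ofReal_mul_I]

theorem hasTemperateGrowth_cexp_re_sq_sub_im_sq (κ : ℝ) :
    Function.HasTemperateGrowth
      (fun w : ℂ ↦ cexp ((κ * (w.re ^ 2 - w.im ^ 2) : ℝ) * I)) := by
  have hre : Function.HasTemperateGrowth (fun w : ℂ ↦ w.re) := reCLM.hasTemperateGrowth
  have him : Function.HasTemperateGrowth (fun w : ℂ ↦ w.im) := imCLM.hasTemperateGrowth
  exact hasTemperateGrowth_cexp_ofReal_mul_I.comp
    ((Function.HasTemperateGrowth.const κ).mul ((hre.pow 2).sub (him.pow 2)))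

theorem integrable_cexp_quadratic_re_im {a b : ℂ} (ha : 0 < a.re) (hb : 0 < b.re) (c d : ℂ) :
    Integrable (fun w : ℂ ↦
      cexp (-a * (w.re : ℂ) ^ 2 + c * w.re) * cexp (-b * (w.im : ℂ) ^ 2 + d * w.im)) := by
  have h := (integrable_cexp_quadratic ha c 0).mul_prod (integrable_cexp_quadratic hb d 0)
  simp only [add_zero] at h
  exact (volume_preserving_equiv_real_prod.integrable_comp_emb
    measurableEquivRealProd.measurableEmbedding).mpr h

theorem integral_cexp_quadratic_re_im {a b : ℂ} (ha : 0 < a.re) (hb : 0 < b.re) (c d : ℂ) :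
    ∫ w : ℂ, cexp (-a * (w.re : ℂ) ^ 2 + c * w.re) * cexp (-b * (w.im : ℂ) ^ 2 + d * w.im) =
      (Real.pi / a) ^ (1 / 2 : ℂ) * (Real.pi / b) ^ (1 / 2 : ℂ) *
        cexp (c ^ 2 / (4 * a) + d ^ 2 / (4 * b)) := by
  have h1 := integral_cexp_quadratic (b := -a) (by simpa using ha) c 0
  have h2 := integral_cexp_quadratic (b := -b) (by simpa using hb) d 0
  simp only [add_zero, neg_neg, zero_sub, mul_neg, div_neg] at h1 h2
  have h := volume_preserving_equiv_real_prod.integral_comp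
    measurableEquivRealProd.measurableEmbedding
    (fun p : ℝ × ℝ ↦
      cexp (-a * (p.1 : ℂ) ^ 2 + c * p.1) * cexp (-b * (p.2 : ℂ) ^ 2 + d * p.2))
  simp only [measurableEquivRealProd_apply] at h
  rw [h, Measure.volume_eq_prod, integral_prod_mul (fun x : ℝ ↦ cexp (-a * (x : ℂ) ^ 2 + c * x))
    (fun x : ℝ ↦ cexp (-b * (x : ℂ) ^ 2 + d * x)), h1, h2, Complex.exp_add]
  ring

theorem cpow_half_mul_cpow_half_conj {z : ℂ} (hz : 0 < z.re) :
    z ^ (1 / 2 : ℂ) * (starRingEnd ℂ z) ^ (1 / 2 : ℂ) = (‖z‖ : ℂ) := by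
  have harg : z.arg ≠ Real.pi := by
    rw [Ne, arg_eq_pi_iff, not_and_or, not_lt]
    exact Or.inl hz.le
  have h := cpow_conj z (1 / 2) harg
  have h2 : starRingEnd ℂ (1 / 2 : ℂ) = 1 / 2 := by
    rw [map_div₀, map_one, Complex.conj_ofNat]
  have h3 : ((starRingEnd ℂ z) ^ (1 / 2 : ℂ)) ^ 2 = starRingEnd ℂ z := by
    have := cpow_nat_inv_pow (starRingEnd ℂ z) two_ne_zero
    rwa [Nat.cast_ofNat, ← one_div] at this
  rw [h2] at h
  rw [h, mul_comm, mul_conj, normSq_eq_norm_sq, ← norm_pow, h3, norm_conj]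

theorem integral_gaussian_mul_fourier (Q : 𝓢(ℂ, ℂ)) {ε : ℝ} (hε : 0 < ε) (κ : ℝ) (z₀ : ℂ) :
    ∫ w : ℂ, cexp (-(ε + κ * I) * (w.re : ℂ) ^ 2 + 2 * Real.pi * I * z₀.re * w.re) *
        cexp (-(ε - κ * I) * (w.im : ℂ) ^ 2 + 2 * Real.pi * I * z₀.im * w.im) * 𝓕 Q w =
      ∫ z : ℂ, ((Real.pi / ‖(ε + κ * I : ℂ)‖ : ℝ) : ℂ) *
        cexp (-Real.pi ^ 2 * ((z - z₀).re ^ 2 / (ε + κ * I) + (z - z₀).im ^ 2 / (ε - κ * I))) *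
          Q z := by
  have ha : 0 < (ε + κ * I : ℂ).re := by simpa using hε
  have hb : 0 < (ε - κ * I : ℂ).re := by simpa using hε
  set f : ℂ → ℂ := fun w ↦
    cexp (-(ε + κ * I) * (w.re : ℂ) ^ 2 + 2 * Real.pi * I * z₀.re * w.re) *
      cexp (-(ε - κ * I) * (w.im : ℂ) ^ 2 + 2 * Real.pi * I * z₀.im * w.im) with hf
  have hfi : Integrable f := integrable_cexp_quadratic_re_im ha hb _ _
  have key : ∫ z, 𝓕 f z * Q z = ∫ w, f w * 𝓕 (Q : ℂ → ℂ) w := by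
    simpa using! VectorFourier.integral_fourierIntegral_smul_eq_flip (L := innerₗ ℂ)
      Real.continuous_fourierChar continuous_inner hfi Q.integrable
  rw [fourier_coe, ← key]
  congr 1
  funext z
  congr 1
  rw [Real.fourier_eq']
  have hint : ∀ w : ℂ, cexp (↑(-2 * Real.pi * inner ℝ w z) * I) • f w =
      cexp (-(ε + κ * I) * (w.re : ℂ) ^ 2 + (-2 * Real.pi * I * (z - z₀).re) * w.re) *
      cexp (-(ε - κ * I) * (w.im : ℂ) ^ 2 + (-2 * Real.pi * I * (z - z₀).im) * w.im) := by
    intro w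
    simp only [hf, smul_eq_mul, ← Complex.exp_add, Complex.inner]
    congr 1
    simp only [mul_re, conj_re, conj_im, sub_re, sub_im]
    push_cast
    ring
  simp_rw [hint]
  rw [integral_cexp_quadratic_re_im ha hb]
  have hπ : 0 < ((Real.pi : ℂ) / (ε + κ * I)).re := by
    rw [div_re, ofReal_re, ofReal_im, zero_mul, zero_div, add_zero]
    exact div_pos (mul_pos Real.pi_pos ha) (normSq_pos.mpr (by rintro h; simp [h] at ha))
  have hconj : (Real.pi : ℂ) / (ε - κ * I) = starRingEnd ℂ ((Real.pi : ℂ) / (ε + κ * I)) := by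
    simp [sub_eq_add_neg]
  rw [hconj, cpow_half_mul_cpow_half_conj hπ, norm_div, norm_real, Real.norm_of_nonneg
    Real.pi_pos.le]
  have hexp : ∀ x a : ℂ, (-2 * Real.pi * I * x) ^ 2 / (4 * a) = -Real.pi ^ 2 * (x ^ 2 / a) := by
    intro x a
    rw [show (-2 * Real.pi * I * x) ^ 2 = 4 * (-Real.pi ^ 2 * x ^ 2) by
      linear_combination (4 * Real.pi ^ 2 * x ^ 2) * I_sq, mul_div_mul_left _ _ (by norm_num : (4 : ℂ) ≠ 0),
      mul_div_assoc]
  rw [hexp, hexp, mul_add]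

theorem norm_cexp_quadratic_le_one {a c : ℂ} (ha : 0 ≤ a.re) (hc : c.re = 0) (x : ℝ) :
    ‖cexp (-a * (x : ℂ) ^ 2 + c * x)‖ ≤ 1 := by
  rw [norm_exp, Real.exp_le_one_iff]
  have : (-a * (x : ℂ) ^ 2 + c * x).re = -(a.re * x ^ 2) := by
    rw [← ofReal_pow, add_re, re_mul_ofReal, re_mul_ofReal, hc, zero_mul,
      add_zero, neg_re, neg_mul]
  rw [this, neg_nonpos]
  positivity

theorem integral_chirp_mul_fourier (Q : 𝓢(ℂ, ℂ)) {κ : ℝ} (hκ : 0 < κ) (z₀ : ℂ) :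
    ∫ w : ℂ, cexp (-(κ * I) * (w.re : ℂ) ^ 2 + 2 * Real.pi * I * z₀.re * w.re) *
        cexp (κ * I * (w.im : ℂ) ^ 2 + 2 * Real.pi * I * z₀.im * w.im) * 𝓕 Q w =
      ∫ z : ℂ, ((Real.pi / κ : ℝ) : ℂ) *
        cexp (Real.pi ^ 2 / κ * I * ((z - z₀).re ^ 2 - (z - z₀).im ^ 2)) * Q z := by
  have hne : ∀ ε : ℝ, (ε + κ * I : ℂ) ≠ 0 := fun ε h ↦ hκ.ne' (by simpa using congrArg im h)
  have hne' : ∀ ε : ℝ, (ε - κ * I : ℂ) ≠ 0 := fun ε h ↦ hκ.ne' (by simpa using congrArg im h)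
  have hpos : ∀ᶠ ε : ℝ in 𝓝[>] 0, 0 < ε := self_mem_nhdsWithin
  have hL : Tendsto (fun ε : ℝ ↦ ∫ w : ℂ,
      cexp (-(ε + κ * I) * (w.re : ℂ) ^ 2 + 2 * Real.pi * I * z₀.re * w.re) *
        cexp (-(ε - κ * I) * (w.im : ℂ) ^ 2 + 2 * Real.pi * I * z₀.im * w.im) * 𝓕 Q w)
      (𝓝[>] 0) (𝓝 (∫ w : ℂ,
        cexp (-(κ * I) * (w.re : ℂ) ^ 2 + 2 * Real.pi * I * z₀.re * w.re) *
          cexp (κ * I * (w.im : ℂ) ^ 2 + 2 * Real.pi * I * z₀.im * w.im) * 𝓕 Q w)) := by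
    refine tendsto_integral_filter_of_dominated_convergence (fun w ↦ ‖𝓕 Q w‖) ?_ ?_
      (𝓕 Q).integrable.norm ?_
    · refine Eventually.of_forall fun ε ↦ Continuous.aestronglyMeasurable ?_
      have := (𝓕 Q).continuous
      fun_prop
    · filter_upwards [hpos] with ε hε
      refine Eventually.of_forall fun w ↦ ?_
      rw [norm_mul, norm_mul]
      refine mul_le_of_le_one_left (norm_nonneg _) (mul_le_one₀ ?_ (norm_nonneg _) ?_) <;>
        exact norm_cexp_quadratic_le_one (by simpa using hε.le) (by simp) _
    · refine Eventually.of_forall fun w ↦ tendsto_nhdsWithin_of_tendsto_nhds ?_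
      have : Continuous fun ε : ℝ ↦
          cexp (-(ε + κ * I) * (w.re : ℂ) ^ 2 + 2 * Real.pi * I * z₀.re * w.re) *
            cexp (-(ε - κ * I) * (w.im : ℂ) ^ 2 + 2 * Real.pi * I * z₀.im * w.im) * 𝓕 Q w := by
        fun_prop
      simpa using this.tendsto 0
  have hR : Tendsto (fun ε : ℝ ↦ ∫ z : ℂ, ((Real.pi / ‖(ε + κ * I : ℂ)‖ : ℝ) : ℂ) *
        cexp (-Real.pi ^ 2 * ((z - z₀).re ^ 2 / (ε + κ * I) + (z - z₀).im ^ 2 / (ε - κ * I))) *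
          Q z) (𝓝[>] 0) (𝓝 (∫ z : ℂ, ((Real.pi / κ : ℝ) : ℂ) *
        cexp (Real.pi ^ 2 / κ * I * ((z - z₀).re ^ 2 - (z - z₀).im ^ 2)) * Q z)) := by
    refine tendsto_integral_filter_of_dominated_convergence (fun z ↦ Real.pi / κ * ‖Q z‖) ?_ ?_
      (Q.integrable.norm.const_mul _) ?_
    · refine Eventually.of_forall fun ε ↦ Continuous.aestronglyMeasurable ?_
      have := Q.continuous
      fun_prop
    · filter_upwards [hpos] with ε hε
      refine Eventually.of_forall fun z ↦ ?_
      rw [norm_mul, norm_mul]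
      refine mul_le_mul_of_nonneg_right ?_ (norm_nonneg _)
      have h1 : ‖((Real.pi / ‖(ε + κ * I : ℂ)‖ : ℝ) : ℂ)‖ ≤ Real.pi / κ := by
        rw [norm_real, Real.norm_of_nonneg (by positivity)]
        gcongr
        simpa [abs_of_pos hκ] using abs_im_le_norm (ε + κ * I : ℂ)
      have h2 : ‖cexp (-Real.pi ^ 2 *
          ((z - z₀).re ^ 2 / (ε + κ * I) + (z - z₀).im ^ 2 / (ε - κ * I)))‖ ≤ 1 := by
        rw [norm_exp, Real.exp_le_one_iff]
        have hre : ∀ (x : ℝ) (a : ℂ), 0 ≤ a.re → 0 ≤ ((x : ℂ) ^ 2 / a).re := by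
          intro x a ha
          rw [← ofReal_pow, div_re, ofReal_re, ofReal_im, zero_mul, zero_div, add_zero]
          exact div_nonneg (mul_nonneg (sq_nonneg x) ha) (normSq_nonneg a)
        have h3 := hre (z - z₀).re (ε + κ * I) (by simpa using hε.le)
        have h4 := hre (z - z₀).im (ε - κ * I) (by simpa using hε.le)
        rw [← ofReal_pow, ← ofReal_neg, re_ofReal_mul, add_re]
        exact mul_nonpos_of_nonpos_of_nonneg (neg_nonpos.mpr (sq_nonneg _)) (add_nonneg h3 h4)
      exact (mul_le_mul h1 h2 (norm_nonneg _) (by positivity)).trans_eq (mul_one _)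
    · refine Eventually.of_forall fun z ↦ tendsto_nhdsWithin_of_tendsto_nhds ?_
      have : Continuous fun ε : ℝ ↦ ((Real.pi / ‖(ε + κ * I : ℂ)‖ : ℝ) : ℂ) *
          cexp (-Real.pi ^ 2 *
            ((z - z₀).re ^ 2 / (ε + κ * I) + (z - z₀).im ^ 2 / (ε - κ * I))) * Q z := by
        have h1 : Continuous fun ε : ℝ ↦ Real.pi / ‖(ε + κ * I : ℂ)‖ :=
          continuous_const.div (by fun_prop) fun ε ↦ norm_ne_zero_iff.mpr (hne ε)
        have h2 : Continuous fun ε : ℝ ↦ ((z - z₀).re : ℂ) ^ 2 / (ε + κ * I : ℂ) :=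
          continuous_const.div (by fun_prop) hne
        have h3 : Continuous fun ε : ℝ ↦ ((z - z₀).im : ℂ) ^ 2 / (ε - κ * I : ℂ) :=
          continuous_const.div (by fun_prop) hne'
        fun_prop
      convert this.tendsto 0 using 2
      have hκ' : (κ : ℂ) ≠ 0 := ofReal_ne_zero.mpr hκ.ne'
      congr 2
      · simp [abs_of_pos hκ]
      · congr 1
        rw [ofReal_zero, zero_add, zero_sub]
        field_simp
        linear_combination
          (((z - z₀).re : ℂ) ^ 2 - ((z - z₀).im : ℂ) ^ 2) * I_sq
  refine tendsto_nhds_unique hL (hR.congr' ?_)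
  filter_upwards [hpos] with ε hε
  exact (integral_gaussian_mul_fourier Q hε κ z₀).symm

/-- For `n > 0` and `Q` Schwartz on `ℂ ≅ ℝ²`, the Fourier transform of
`z₀ ↦ (2n/π) ∫ e^{inR(z,z₀)} Q(z) dm(z)` is `ξ ↦ e^{-i(ξ²+ξ̄²)/(16n)} Q̂(ξ)`,
where `Q̂(ξ) = ∫ e^{-i Re(z ξ̄)} Q(z) dm(z)`. -/
theorem stmt_2 (n : ℝ) (hn : 0 < n) (Q : SchwartzMap ℂ ℂ) (ξ : ℂ) :
    (∫ z₀ : ℂ, Complex.exp (-Complex.I * (((z₀ * (starRingEnd ℂ) ξ).re : ℝ) : ℂ)) *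
        (((2 * n / Real.pi : ℝ) : ℂ) *
          ∫ z : ℂ, Complex.exp (Complex.I * (n : ℂ) *
            ((z - z₀) ^ 2 + ((starRingEnd ℂ) (z - z₀)) ^ 2)) * Q z)) =
      Complex.exp (-Complex.I * (ξ ^ 2 + (starRingEnd ℂ ξ) ^ 2) / (16 * (n : ℂ))) *
        ∫ z : ℂ, Complex.exp (-Complex.I * (((z * (starRingEnd ℂ) ξ).re : ℝ) : ℂ)) * Q z := by
  set κ : ℝ := Real.pi ^ 2 / (2 * n) with hκ_def
  have hκ : 0 < κ := by positivity
  have hn' : (n : ℂ) ≠ 0 := ofReal_ne_zero.mpr hn.ne'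
  have hπ : (Real.pi : ℂ) ≠ 0 := ofReal_ne_zero.mpr Real.pi_ne_zero
  set M : ℂ → ℂ := fun w ↦ cexp ((-κ * (w.re ^ 2 - w.im ^ 2) : ℝ) * I) with hM_def
  have hM : M.HasTemperateGrowth := hasTemperateGrowth_cexp_re_sq_sub_im_sq (-κ)
  set S : 𝓢(ℂ, ℂ) := smulLeftCLM ℂ M (𝓕 Q) with hS_def
  have hS : ∀ z₀ : ℂ, 𝓕⁻ S z₀ = ((2 * n / Real.pi : ℝ) : ℂ) *
      ∫ z : ℂ, cexp (I * (n : ℂ) * ((z - z₀) ^ 2 + (starRingEnd ℂ (z - z₀)) ^ 2)) * Q z := by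
    intro z₀
    rw [fourierInv_coe, Real.fourierInv_eq', ← integral_const_mul]
    refine Eq.trans (integral_congr_ae (Eventually.of_forall fun w ↦ ?_))
      ((integral_chirp_mul_fourier Q hκ z₀).trans
        (integral_congr_ae (Eventually.of_forall fun z ↦ ?_)))
    · simp only [hS_def, smulLeftCLM_apply_apply hM, smul_eq_mul, ← mul_assoc]
      simp only [hM_def, ← Complex.exp_add, Complex.inner, mul_re, conj_re, conj_im]
      congr 2
      push_cast
      ring
    · simp only [← mul_assoc]
      congr 3
      · rw [hκ_def]
        field_simp
      · have h1 : (Real.pi : ℂ) ^ 2 / κ = 2 * n := by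
          rw [hκ_def]
          push_cast
          field_simp
        rw [h1]
        generalize z - z₀ = u
        conv_rhs => rw [← re_add_im u]
        simp only [map_add, map_mul, conj_ofReal, conj_I]
        linear_combination (-2 * I * n * (u.im : ℂ) ^ 2) * I_sq
  have hF : ∀ f : ℂ → ℂ, ∫ z : ℂ, cexp (-I * (((z * starRingEnd ℂ ξ).re : ℝ) : ℂ)) * f z =
      𝓕 f (ξ / (2 * Real.pi : ℝ)) := by
    intro f
    rw [Real.fourier_eq']
    refine integral_congr_ae (Eventually.of_forall fun z ↦ ?_)
    simp only [smul_eq_mul]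
    congr 2
    simp only [Complex.inner, mul_re, conj_re, conj_im, div_ofReal_re, div_ofReal_im]
    push_cast
    field_simp
  simp_rw [← hS]
  rw [hF, hF, ← fourier_coe, ← fourier_coe, FourierTransform.fourier_fourierInv_eq, hS_def,
    smulLeftCLM_apply_apply hM, smul_eq_mul]
  congr 1
  simp only [hM_def, div_ofReal_re, div_ofReal_im]
  congr 1
  conv_rhs => rw [← re_add_im ξ]
  simp only [map_add, map_mul, conj_ofReal, conj_I, hκ_def]
  push_cast
  field_simp
  linear_combination (16 * (ξ.im : ℂ) ^ 2) * I_sq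
end

section
/- Let 2 < p < ∞, r > 0, set l = (2+r)p/(2+p), and let n > 1 and z₀ ∈ Ω. Then there exists C_{r,p} < ∞, independent of n, z₀ and g, such that for every function g continuously differentiable on a neighbourhood of the closed unit disc one has ‖ (1/2π) ∫_{∂Ω} e^{−inR(z',z₀)} g(z') (z − z')^{−1} z' dσ(z') ‖_{L^p(Ω, dz)} ≤ C_{r,p} n^{(1 − 2/((1+r)p))(1 − 2/(2+r))} ‖g‖_{W^{1,l}(Ω)}, where σ is arclength measure on the unit circle ∂Ω. -/
open Complex MeasureTheory

/-- Wirtinger derivative `∂`. -/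
noncomputable def wdz (g : ℂ → ℂ) (z : ℂ) : ℂ :=
  (fderiv ℝ g z 1 - Complex.I * fderiv ℝ g z Complex.I) / 2

/-- Wirtinger derivative `∂̄`. -/
noncomputable def wdzbar (g : ℂ → ℂ) (z : ℂ) : ℂ :=
  (fderiv ℝ g z 1 + Complex.I * fderiv ℝ g z Complex.I) / 2

/-- The `W^{1,l}(Ω)` norm `‖g‖_{L^l(Ω)} + ‖∂g‖_{L^l(Ω)} + ‖∂̄g‖_{L^l(Ω)}`,
where `Ω` is the open unit disc. -/
noncomputable def W1Norm (g : ℂ → ℂ) (l : ℝ) : ℝ :=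
  (eLpNorm g (ENNReal.ofReal l) (volume.restrict (Metric.ball (0 : ℂ) 1))).toReal +
  (eLpNorm (wdz g) (ENNReal.ofReal l) (volume.restrict (Metric.ball (0 : ℂ) 1))).toReal +
  (eLpNorm (wdzbar g) (ENNReal.ofReal l) (volume.restrict (Metric.ball (0 : ℂ) 1))).toReal

open scoped ENNReal

theorem lintegral_rpow_mul_rpow_mul_rpow_le {α : Type*} [MeasurableSpace α] {μ : Measure α}
    {f g h : α → ℝ≥0∞} (hf : AEMeasurable f μ) (hg : AEMeasurable g μ) (hh : AEMeasurable h μ)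
    {a b c : ℝ} (ha : 0 ≤ a) (hb : 0 ≤ b) (hc : 0 ≤ c) (habc : a + b + c = 1) :
    ∫⁻ x, f x ^ a * g x ^ b * h x ^ c ∂μ ≤
      (∫⁻ x, f x ∂μ) ^ a * (∫⁻ x, g x ∂μ) ^ b * (∫⁻ x, h x ∂μ) ^ c := by
  have := ENNReal.lintegral_prod_norm_pow_le (μ := μ) Finset.univ (f := ![f, g, h])
    (p := ![a, b, c]) (by simp [Fin.forall_fin_succ, hf, hg, hh])
    (by simp [Fin.sum_univ_three, habc]) (by simp [Fin.forall_fin_succ, ha, hb, hc])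
  simpa [Fin.prod_univ_three] using this

/-- An off-diagonal **Schur test**: an integral operator with kernel `k` is bounded from `L^q` to
`L^p` when suitable powers of `k` are uniformly integrable in each variable. -/
theorem lintegral_lintegral_kernel_rpow_le {X Y : Type*} [MeasurableSpace X] [MeasurableSpace Y]
    {μ : Measure X} {ν : Measure Y} [SFinite μ] [SFinite ν] {k : X → Y → ℝ≥0∞}
    (hk : Measurable (Function.uncurry k)) {f : Y → ℝ≥0∞} (hf : AEMeasurable f ν)
    {p q a c : ℝ} (hq : 1 ≤ q) (hqp : q ≤ p) (ha : 0 ≤ a) (hc : 0 ≤ c)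
    (hac : a / p + c * (1 - 1 / q) = 1) {A B : ℝ≥0∞}
    (hA : ∀ᵐ x ∂μ, ∫⁻ y, k x y ^ c ∂ν ≤ A) (hB : ∀ᵐ y ∂ν, ∫⁻ x, k x y ^ a ∂μ ≤ B) :
    (∫⁻ x, (∫⁻ y, k x y * f y ∂ν) ^ p ∂μ) ^ (1 / p) ≤
      B ^ (1 / p) * A ^ (1 - 1 / q) * (∫⁻ y, f y ^ q ∂ν) ^ (1 / q) := by
  have hq0 : 0 < q := by linarith
  have hp0 : 0 < p := by linarith
  have hqi : 0 ≤ 1 - 1 / q := by rw [sub_nonneg, div_le_one hq0]; exact hq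
  have hpq : 0 ≤ 1 / q - 1 / p := by
    rw [sub_nonneg]; exact one_div_le_one_div_of_le hq0 hqp
  set N := ∫⁻ y, f y ^ q ∂ν with hN
  have hkx : ∀ x, Measurable (k x) := fun x => hk.comp measurable_prodMk_left
  have key : ∀ᵐ x ∂μ, (∫⁻ y, k x y * f y ∂ν) ^ p ≤
      (∫⁻ y, k x y ^ a * f y ^ q ∂ν) * (N ^ (1 / q - 1 / p) * A ^ (1 - 1 / q)) ^ p := by
    filter_upwards [hA] with x hx
    have h1 : ∫⁻ y, k x y * f y ∂ν ≤ (∫⁻ y, k x y ^ a * f y ^ q ∂ν) ^ (1 / p) *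
        N ^ (1 / q - 1 / p) * A ^ (1 - 1 / q) := by
      calc ∫⁻ y, k x y * f y ∂ν
          = ∫⁻ y, (k x y ^ a * f y ^ q) ^ (1 / p) * (f y ^ q) ^ (1 / q - 1 / p) *
              (k x y ^ c) ^ (1 - 1 / q) ∂ν := by
            refine lintegral_congr fun y => ?_
            rw [ENNReal.mul_rpow_of_nonneg _ _ (by positivity), ← ENNReal.rpow_mul,
              ← ENNReal.rpow_mul, ← ENNReal.rpow_mul, ← ENNReal.rpow_mul]
            calc k x y * f y = k x y ^ (a * (1 / p) + c * (1 - 1 / q)) *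
                  f y ^ (q * (1 / p) + q * (1 / q - 1 / p)) := by
                  rw [mul_one_div, hac, ENNReal.rpow_one]
                  have : q * (1 / p) + q * (1 / q - 1 / p) = 1 := by field_simp; ring
                  rw [this, ENNReal.rpow_one]
              _ = _ := by
                  rw [ENNReal.rpow_add_of_nonneg _ _ (by positivity) (by positivity),
                    ENNReal.rpow_add_of_nonneg _ _ (by positivity) (by positivity)]
                  ring
        _ ≤ (∫⁻ y, k x y ^ a * f y ^ q ∂ν) ^ (1 / p) * N ^ (1 / q - 1 / p) *
              (∫⁻ y, k x y ^ c ∂ν) ^ (1 - 1 / q) :=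
            lintegral_rpow_mul_rpow_mul_rpow_le
              (((hkx x).pow_const a).aemeasurable.mul (hf.pow_const q)) (hf.pow_const q)
              ((hkx x).pow_const c).aemeasurable (by positivity) hpq hqi (by ring)
        _ ≤ _ := by gcongr
    calc _ ≤ _ := ENNReal.rpow_le_rpow h1 hp0.le
      _ = _ := by
        rw [mul_assoc, ENNReal.mul_rpow_of_nonneg _ _ hp0.le, ← ENNReal.rpow_mul,
          one_div_mul_cancel hp0.ne', ENNReal.rpow_one]
  have hmeas : AEMeasurable (Function.uncurry fun x y => k x y ^ a * f y ^ q) (μ.prod ν) :=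
    (hk.pow_const a).aemeasurable.mul
      ((hf.pow_const q).comp_quasiMeasurePreserving Measure.quasiMeasurePreserving_snd)
  have hmeas' : AEMeasurable (fun x => ∫⁻ y, k x y ^ a * f y ^ q ∂ν) μ :=
    hmeas.lintegral_prod_right'
  have h2 : ∫⁻ x, ∫⁻ y, k x y ^ a * f y ^ q ∂ν ∂μ ≤ B * N := by
    rw [lintegral_lintegral_swap hmeas, hN, ← lintegral_const_mul'' _ (hf.pow_const q)]
    refine lintegral_mono_ae ?_
    filter_upwards [hB] with y hy
    have hky : Measurable fun x => k x y := hk.comp measurable_prodMk_right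
    rw [lintegral_mul_const _ (hky.pow_const a)]
    gcongr
  calc (∫⁻ x, (∫⁻ y, k x y * f y ∂ν) ^ p ∂μ) ^ (1 / p)
      ≤ ((B * N) * (N ^ (1 / q - 1 / p) * A ^ (1 - 1 / q)) ^ p) ^ (1 / p) := by
        gcongr
        refine (lintegral_mono_ae key).trans ?_
        rw [lintegral_mul_const'' _ hmeas']
        gcongr
    _ = B ^ (1 / p) * A ^ (1 - 1 / q) * (N ^ (1 / p) * N ^ (1 / q - 1 / p)) := by
        have hp' : 0 ≤ 1 / p := by positivity
        rw [ENNReal.mul_rpow_of_nonneg _ _ hp', ENNReal.mul_rpow_of_nonneg _ _ hp',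
          ← ENNReal.rpow_mul, mul_one_div_cancel hp0.ne', ENNReal.rpow_one]
        ring
    _ = _ := by
        rw [← ENNReal.rpow_add_of_nonneg _ _ (by positivity) hpq]
        congr 2; ring

theorem lintegral_ball_enorm_inv_rpow_lt_top {a : ℝ} (ha2 : a < 2) (R : ℝ) :
    ∫⁻ u in Metric.ball (0 : ℂ) R, ‖u‖ₑ⁻¹ ^ a < ∞ := by
  have h : IntegrableOn (fun x : ℝ => x ^ (Module.finrank ℝ ℂ - 1) • x ^ (-a)) (Set.Ioo 0 R) := by
    have h1 : IntegrableOn (fun x : ℝ => x ^ (1 - a)) (Set.Ioc 0 |R|) := by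
      rw [← intervalIntegrable_iff_integrableOn_Ioc_of_le (abs_nonneg R)]
      exact intervalIntegral.intervalIntegrable_rpow' (by linarith)
    refine (h1.mono_set (Set.Ioo_subset_Ioc_self.trans
      (Set.Ioc_subset_Ioc_right (le_abs_self R)))).congr_fun ?_ measurableSet_Ioo
    intro x hx
    simp only [Complex.finrank_real_complex, smul_eq_mul]
    rw [sub_eq_add_neg, Real.rpow_add hx.1, Real.rpow_one]; norm_num
  have h2 := (integrableOn_fun_norm_addHaar (E := ℂ) (f := fun x : ℝ => x ^ (-a)) volume
    (r := R)).2 h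
  refine lt_of_le_of_lt (lintegral_mono_ae ?_) h2.2
  have h0 : ∀ᵐ u : ℂ, u ≠ 0 := by simp [ae_iff]
  filter_upwards [ae_restrict_of_ae h0] with u hu
  have hpos : 0 < ‖u‖ := norm_pos_iff.2 hu
  rw [Real.enorm_of_nonneg (by positivity), ← ofReal_norm, ← ENNReal.ofReal_inv_of_pos hpos,
    ENNReal.ofReal_rpow_of_pos (by positivity), Real.rpow_neg hpos.le, Real.inv_rpow hpos.le]

theorem exists_lintegral_ball_enorm_sub_inv_rpow_le {a : ℝ} (ha2 : a < 2) :
    ∃ B : ℝ≥0∞, B ≠ ∞ ∧ ∀ ζ : ℂ, ‖ζ‖ = 1 →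
      ∫⁻ z in Metric.ball (0 : ℂ) 1, ‖z - ζ‖ₑ⁻¹ ^ a ≤ B := by
  refine ⟨_, (lintegral_ball_enorm_inv_rpow_lt_top ha2 2).ne, fun ζ hζ => ?_⟩
  rw [← lintegral_indicator measurableSet_ball, ← lintegral_indicator measurableSet_ball,
    ← lintegral_sub_right_eq_self ((Metric.ball (0 : ℂ) 2).indicator _) ζ]
  refine lintegral_mono fun z => ?_
  by_cases hz : z ∈ Metric.ball (0 : ℂ) 1
  · have : z - ζ ∈ Metric.ball (0 : ℂ) 2 := by
      rw [mem_ball_zero_iff] at hz ⊢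
      linarith [norm_sub_le z ζ]
    simp [hz, this]
  · simp [hz]

theorem abs_sin_half_le_norm_sub_exp (z : ℂ) (t : ℝ) :
    |Real.sin ((t - arg z) / 2)| ≤ ‖z - exp (I * t)‖ := by
  have h1 : ‖exp (I * t) - exp (I * arg z)‖ = 2 * |Real.sin ((t - arg z) / 2)| := by
    have : exp (I * t) - exp (I * arg z) =
        exp (I * arg z) * (exp (I * ((t - arg z : ℝ) : ℂ)) - 1) := by
      rw [mul_sub, ← Complex.exp_add]; push_cast; ring_nf
    rw [this, norm_mul, Complex.norm_exp_I_mul_ofReal, one_mul,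
      Complex.norm_exp_I_mul_ofReal_sub_one]
    simp
  have h2 : ‖z - exp (I * arg z)‖ ≤ ‖z - exp (I * t)‖ := by
    have : z - exp (I * arg z) = ((‖z‖ - 1 : ℝ) : ℂ) * exp (I * arg z) := by
      have hz := norm_mul_exp_arg_mul_I z
      rw [mul_comm I, ofReal_sub, sub_mul, hz, ofReal_one, one_mul]
    rw [this, norm_mul, Complex.norm_exp_I_mul_ofReal, mul_one, Complex.norm_real]
    calc ‖‖z‖ - 1‖ = |‖z‖ - ‖exp (I * t)‖| := by
          rw [Complex.norm_exp_I_mul_ofReal, Real.norm_eq_abs]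
      _ ≤ _ := abs_norm_sub_norm_le _ _
  have h3 : ‖exp (I * t) - exp (I * arg z)‖ ≤ ‖z - exp (I * arg z)‖ + ‖z - exp (I * t)‖ := by
    rw [← norm_neg (z - exp (I * t))]
    refine (le_of_eq ?_).trans (norm_add_le _ _)
    congr 1; ring
  linarith

theorem exists_lintegral_circle_enorm_sub_inv_rpow_le {c : ℝ} (hc : 0 ≤ c) (hc1 : c < 1) :
    ∃ A : ℝ≥0∞, A ≠ ∞ ∧ ∀ z : ℂ,
      ∫⁻ t in Set.Ioc 0 (2 * Real.pi), ‖z - exp (I * t)‖ₑ⁻¹ ^ c ≤ A := by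
  let h : ℝ → ℝ≥0∞ := fun x => ‖Real.sin (x / 2)‖ₑ⁻¹ ^ c
  have hper : Function.Periodic h (2 * Real.pi) := fun x => by
    simp only [h, add_div, mul_div_cancel_left₀ Real.pi two_ne_zero, Real.sin_add_pi, enorm_neg]
  have hfin : ∫⁻ x in Set.Ioc (-Real.pi) Real.pi, h x < ∞ := by
    have h1 : IntegrableOn (fun x : ℝ => Real.pi ^ c * |x| ^ (-c))
        (Set.Ioc (-Real.pi) Real.pi) := by
      rw [← intervalIntegrable_iff_integrableOn_Ioc_of_le (by linarith [Real.pi_pos])]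
      refine IntervalIntegrable.const_mul ?_ _
      have h0 : IntervalIntegrable (fun x : ℝ => |x| ^ (-c)) volume 0 Real.pi := by
        refine (intervalIntegral.intervalIntegrable_rpow' (r := -c) (by linarith)).congr ?_
        intro x hx
        rw [Set.uIoc_of_le Real.pi_pos.le] at hx
        simp only [abs_of_pos hx.1]
      refine IntervalIntegrable.trans (b := 0) ?_ h0
      simpa using ((IntervalIntegrable.iff_comp_neg).1 h0).symm
    refine lt_of_le_of_lt (lintegral_mono_ae ?_) h1.2
    have h0 : ∀ᵐ u : ℝ, u ≠ 0 := by simp [ae_iff]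
    filter_upwards [ae_restrict_of_ae h0, ae_restrict_mem measurableSet_Ioc] with x hx0 hx
    have hx' : 0 < |x| := abs_pos.2 hx0
    have hs : |x| / Real.pi ≤ |Real.sin (x / 2)| := by
      have := Real.mul_abs_le_abs_sin (x := x / 2) (by
        rw [abs_div, abs_two]; gcongr; exact abs_le.2 ⟨hx.1.le, hx.2⟩)
      rw [abs_div, abs_two] at this
      convert this using 1
      field_simp
    have hs' : 0 < |Real.sin (x / 2)| := lt_of_lt_of_le (by positivity) hs
    rw [Real.enorm_of_nonneg (by positivity)]
    simp only [h]
    rw [← ofReal_norm, Real.norm_eq_abs, ← ENNReal.ofReal_inv_of_pos hs',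
      ENNReal.ofReal_rpow_of_pos (by positivity)]
    refine ENNReal.ofReal_le_ofReal ?_
    calc _ ≤ (|x| / Real.pi)⁻¹ ^ c := by gcongr
      _ = _ := by
        rw [inv_div, Real.div_rpow Real.pi_pos.le hx'.le, Real.rpow_neg hx'.le, div_eq_mul_inv]
  refine ⟨_, hfin.ne, fun z => ?_⟩
  calc ∫⁻ t in Set.Ioc 0 (2 * Real.pi), ‖z - exp (I * t)‖ₑ⁻¹ ^ c
      ≤ ∫⁻ t in Set.Ioc 0 (2 * Real.pi), h (t - arg z) := by
        refine lintegral_mono fun t => ?_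
        simp only [h]
        gcongr
        rw [← ofReal_norm, ← ofReal_norm]
        exact ENNReal.ofReal_le_ofReal (abs_sin_half_le_norm_sub_exp z t)
    _ = ∫⁻ t in Set.Ioc (-Real.pi + arg z) (-Real.pi + arg z + 2 * Real.pi), h (t - arg z) := by
        have := (isAddFundamentalDomain_Ioc Real.two_pi_pos 0).setLIntegral_eq
          (isAddFundamentalDomain_Ioc Real.two_pi_pos (-Real.pi + arg z)) (fun t => h (t - arg z))
          (by
            rintro ⟨g, hg⟩ x
            obtain ⟨m, rfl⟩ := hg
            have := (hper.zsmul m) (x - arg z)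
            simp [AddSubgroup.vadd_def] at this ⊢
            rw [← this]
            congr 1; ring)
        simpa using this
    _ = ∫⁻ x in Set.Ioc (-Real.pi) Real.pi, h x := by
        rw [← lintegral_indicator measurableSet_Ioc, ← lintegral_indicator measurableSet_Ioc,
          ← lintegral_sub_right_eq_self ((Set.Ioc (-Real.pi) Real.pi).indicator _) (arg z)]
        refine lintegral_congr fun t => ?_
        have : t ∈ Set.Ioc (-Real.pi + arg z) (-Real.pi + arg z + 2 * Real.pi) ↔
            t - arg z ∈ Set.Ioc (-Real.pi) Real.pi := by
          simp only [Set.mem_Ioc]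
          constructor <;> rintro ⟨h1, h2⟩ <;> constructor <;> linarith
        by_cases ht : t - arg z ∈ Set.Ioc (-Real.pi) Real.pi
        · rw [Set.indicator_of_mem (this.2 ht), Set.indicator_of_mem ht]
        · rw [Set.indicator_of_notMem (mt this.1 ht), Set.indicator_of_notMem ht]

theorem lintegral_comp_add_smul_sub {Φ : ℂ → ℝ≥0∞} (hΦ : Measurable Φ) (ζ : ℂ) {s : ℝ}
    (hs : 0 < s) :
    ∫⁻ w : ℂ, Φ (ζ + s * (w - ζ)) = ENNReal.ofReal (s ^ 2)⁻¹ * ∫⁻ u, Φ u := by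
  have h1 : ∫⁻ w : ℂ, Φ (ζ + s * (w - ζ)) = ∫⁻ w : ℂ, Φ (ζ + s • w) := by
    rw [← lintegral_sub_right_eq_self (fun w : ℂ => Φ (ζ + s • w)) ζ]
    simp
  have h2 : ∫⁻ w : ℂ, Φ (ζ + s • w) = ∫⁻ w, Φ (ζ + w) ∂(Measure.map (s • ·) volume) := by
    rw [lintegral_map (by fun_prop) (by fun_prop)]
  rw [h1, h2, Measure.map_addHaar_smul _ hs.ne', lintegral_smul_measure,
    lintegral_add_left_eq_self]
  simp [abs_of_pos hs]

theorem lintegral_Ioc_inv_pow_three_le {ρ : ℝ} (hρ : 0 < ρ) :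
    ∫⁻ s in Set.Ioc (0 : ℝ) 1, (Set.Ioi ρ).indicator (fun s => ENNReal.ofReal (s ^ 3)⁻¹) s ≤
      ENNReal.ofReal (1 / (2 * ρ ^ 2)) := by
  rw [setLIntegral_indicator measurableSet_Ioi]
  have hsub : Set.Ioi ρ ∩ Set.Ioc 0 1 ⊆ Set.Ioi ρ := Set.inter_subset_left
  refine (lintegral_mono_set hsub).trans ?_
  have hint := integrableOn_Ioi_rpow_of_lt (a := -3) (by norm_num) hρ
  have hval := integral_Ioi_rpow_of_lt (a := -3) (by norm_num) hρ
  have h1 : ∫⁻ s in Set.Ioi ρ, ENNReal.ofReal (s ^ 3)⁻¹ =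
      ∫⁻ s in Set.Ioi ρ, ENNReal.ofReal (s ^ (-3 : ℝ)) := by
    refine setLIntegral_congr_fun measurableSet_Ioi fun s hs => ?_
    have hs0 : 0 < s := hρ.trans hs
    rw [Real.rpow_neg hs0.le]; norm_cast
  rw [h1, ← ofReal_integral_eq_lintegral_ofReal hint, hval]
  · refine ENNReal.ofReal_le_ofReal (le_of_eq ?_)
    have : (-3 : ℝ) + 1 = -(2 : ℕ) := by norm_num
    rw [this, Real.rpow_neg hρ.le, Real.rpow_natCast]
    field_simp
    norm_num
  · filter_upwards [ae_restrict_mem measurableSet_Ioi] with s hs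
    exact Real.rpow_nonneg (hρ.trans hs).le _

theorem add_mul_sub_mem_ball {ζ w : ℂ} (hζ : ‖ζ‖ = 1) (hw : w ∈ Metric.ball (0 : ℂ) 1) {s : ℝ}
    (hs : s ∈ Set.Ioc (0 : ℝ) 1) : ζ + s * (w - ζ) ∈ Metric.ball (0 : ℂ) 1 := by
  rw [mem_ball_zero_iff] at hw ⊢
  have : ζ + s * (w - ζ) = ((1 - s : ℝ) : ℂ) * ζ + (s : ℂ) * w := by push_cast; ring
  rw [this]
  refine (norm_add_le _ _).trans_lt ?_
  rw [norm_mul, norm_mul, hζ, norm_real, norm_real, Real.norm_of_nonneg hs.1.le,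
    Real.norm_of_nonneg (by linarith [hs.2])]
  nlinarith [hs.1]

/-- Averaging a function over all segments from a boundary point into the disc is controlled by
its Riesz potential at that point. -/
theorem lintegral_lintegral_segment_le {F : ℂ → ℝ≥0∞} (hF : Measurable F) {ζ : ℂ}
    (hζ : ‖ζ‖ = 1) :
    ∫⁻ w in Metric.ball (0 : ℂ) 1, ∫⁻ s in Set.Ioc (0 : ℝ) 1,
        F (ζ + s * (w - ζ)) * ‖w - ζ‖ₑ ≤
      2 * ∫⁻ u in Metric.ball (0 : ℂ) 1, ‖ζ - u‖ₑ⁻¹ * F u := by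
  have hmeas1 : Measurable (Function.uncurry fun (w : ℂ) (s : ℝ) =>
      F (ζ + s * (w - ζ)) * ‖w - ζ‖ₑ) := by
    refine (hF.comp ?_).mul ?_ <;> fun_prop
  have hset : MeasurableSet {x : ℝ × ℂ | ‖x.2 - ζ‖ / 2 < x.1} :=
    measurableSet_lt (by fun_prop) (by fun_prop)
  obtain ⟨Ψ, hΨs⟩ : ∃ Ψ : ℝ → ℂ → ℝ≥0∞, ∀ s u, Ψ s u =
      (Set.Ioi (‖u - ζ‖ / 2)).indicator (fun s => ENNReal.ofReal (s ^ 3)⁻¹) s *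
        (F u * ‖u - ζ‖ₑ) := ⟨_, fun _ _ => rfl⟩
  have hΨ : Measurable (Function.uncurry Ψ) := by
    have : Function.uncurry Ψ = fun x : ℝ × ℂ => {x : ℝ × ℂ | ‖x.2 - ζ‖ / 2 < x.1}.indicator
        (fun x => ENNReal.ofReal (x.1 ^ 3)⁻¹) x * (F x.2 * ‖x.2 - ζ‖ₑ) := by
      ext x
      rw [Function.uncurry_def]
      simp only [hΨs, Set.indicator, Set.mem_Ioi, Set.mem_ofPred_eq]
    rw [this]
    refine Measurable.mul (Measurable.indicator (by fun_prop) hset)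
      ((hF.comp measurable_snd).mul (by fun_prop))
  calc _ = ∫⁻ s in Set.Ioc (0 : ℝ) 1, ∫⁻ w in Metric.ball (0 : ℂ) 1,
        F (ζ + s * (w - ζ)) * ‖w - ζ‖ₑ := lintegral_lintegral_swap hmeas1.aemeasurable
    _ ≤ ∫⁻ s in Set.Ioc (0 : ℝ) 1, ∫⁻ u in Metric.ball (0 : ℂ) 1, Ψ s u := by
        refine setLIntegral_mono' measurableSet_Ioc fun s hs => ?_
        have hΨm : Measurable (Ψ s) := hΨ.comp measurable_prodMk_left
        have hs2 : ENNReal.ofReal (s ^ 2) ≠ 0 := by simp [hs.1.ne']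
        calc ∫⁻ w in Metric.ball (0 : ℂ) 1, F (ζ + s * (w - ζ)) * ‖w - ζ‖ₑ
            ≤ ∫⁻ w : ℂ, ENNReal.ofReal (s ^ 2) *
                (Metric.ball (0 : ℂ) 1).indicator (Ψ s) (ζ + s * (w - ζ)) := by
              rw [← lintegral_indicator measurableSet_ball]
              refine lintegral_mono fun w => ?_
              by_cases hw : w ∈ Metric.ball (0 : ℂ) 1
              swap
              · simp [hw]
              rw [Set.indicator_of_mem hw,
                Set.indicator_of_mem (add_mul_sub_mem_ball hζ hw hs)]
              have hn : ‖ζ + s * (w - ζ) - ζ‖ = s * ‖w - ζ‖ := by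
                rw [add_sub_cancel_left, norm_mul, norm_real, Real.norm_of_nonneg hs.1.le]
              have hlt : s ∈ Set.Ioi (‖ζ + s * (w - ζ) - ζ‖ / 2) := by
                rw [hn, Set.mem_Ioi]
                have : ‖w - ζ‖ < 2 := by
                  rw [mem_ball_zero_iff] at hw
                  linarith [norm_sub_le w ζ]
                nlinarith [hs.1]
              rw [hΨs]
              rw [Set.indicator_of_mem hlt, ← ofReal_norm, ← ofReal_norm, hn]
              have h3 : ENNReal.ofReal ‖w - ζ‖ = ENNReal.ofReal (s ^ 2) *
                  ENNReal.ofReal (s ^ 3)⁻¹ * ENNReal.ofReal (s * ‖w - ζ‖) := by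
                have := hs.1
                rw [← ENNReal.ofReal_mul (by positivity), ← ENNReal.ofReal_mul (by positivity)]
                congr 1
                field_simp
              rw [h3]
              exact le_of_eq (by ring)
          _ = ∫⁻ u in Metric.ball (0 : ℂ) 1, Ψ s u := by
              have hind := hΨm.indicator (measurableSet_ball (x := (0 : ℂ)) (ε := 1))
              rw [lintegral_const_mul _ (f := fun w => (Metric.ball (0 : ℂ) 1).indicator (Ψ s) (ζ + s * (w - ζ)))
                  (hind.comp (by fun_prop)),
                lintegral_comp_add_smul_sub hind ζ hs.1, ← mul_assoc,
                ENNReal.ofReal_inv_of_pos (pow_pos hs.1 2),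
                ENNReal.mul_inv_cancel hs2 ENNReal.ofReal_ne_top, one_mul,
                lintegral_indicator measurableSet_ball]
    _ = ∫⁻ u in Metric.ball (0 : ℂ) 1, ∫⁻ s in Set.Ioc (0 : ℝ) 1, Ψ s u :=
        lintegral_lintegral_swap hΨ.aemeasurable
    _ ≤ ∫⁻ u in Metric.ball (0 : ℂ) 1, 2 * (‖ζ - u‖ₑ⁻¹ * F u) := by
        refine setLIntegral_mono' measurableSet_ball fun u hu => ?_
        have hpos : 0 < ‖u - ζ‖ := by
          rw [norm_pos_iff, sub_ne_zero]
          rintro rfl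
          simp [hζ] at hu
        simp only [hΨs]
        rw [lintegral_mul_const _ (Measurable.indicator (by fun_prop) measurableSet_Ioi)]
        refine (mul_le_mul_left (lintegral_Ioc_inv_pow_three_le (half_pos hpos)) _).trans
          (le_of_eq ?_)
        rw [← enorm_neg (ζ - u), neg_sub, ← ofReal_norm (u - ζ), ← ENNReal.ofReal_inv_of_pos hpos,
          mul_comm (F u), ← mul_assoc, ← mul_assoc, ← ENNReal.ofReal_mul (by positivity),
          ← ENNReal.ofReal_ofNat, ← ENNReal.ofReal_mul (by positivity)]
        congr 2
        field_simp
    _ = _ := lintegral_const_mul' _ _ (by norm_num)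

theorem norm_fderiv_apply_le_wdz_add_wdzbar (g : ℂ → ℂ) (z v : ℂ) :
    ‖fderiv ℝ g z v‖ ≤ (‖wdz g z‖ + ‖wdzbar g z‖) * ‖v‖ := by
  have hv : v = v.re • (1 : ℂ) + v.im • I := by simp
  have h : fderiv ℝ g z v = wdz g z * v + wdzbar g z * (starRingEnd ℂ) v := by
    conv_lhs => rw [hv, map_add, map_smul, map_smul]
    have h2 : (starRingEnd ℂ) v = v.re - v.im * I := by
      apply Complex.ext <;> simp
    rw [h2]
    simp only [wdz, wdzbar, real_smul]
    linear_combination ((v.im : ℂ) * fderiv ℝ g z I) * I_sq +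
      (fderiv ℝ g z 1 - I * fderiv ℝ g z I) / 2 * re_add_im v
  rw [h]
  refine (norm_add_le _ _).trans (le_of_eq ?_)
  rw [norm_mul, norm_mul, norm_conj]; ring

theorem measurable_wdz (g : ℂ → ℂ) : Measurable (wdz g) := by
  unfold wdz
  have := measurable_fderiv_apply_const ℝ g (1 : ℂ)
  have := measurable_fderiv_apply_const ℝ g I
  fun_prop

theorem measurable_wdzbar (g : ℂ → ℂ) : Measurable (wdzbar g) := by
  unfold wdzbar
  have := measurable_fderiv_apply_const ℝ g (1 : ℂ)
  have := measurable_fderiv_apply_const ℝ g I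
  fun_prop

theorem enorm_sub_le_lintegral_segment {g : ℂ → ℂ} {U : Set ℂ} (hU : IsOpen U)
    (hsub : Metric.closedBall (0 : ℂ) 1 ⊆ U) (hg : ContDiffOn ℝ 1 g U) {ζ w : ℂ}
    (hζ : ‖ζ‖ = 1) (hw : w ∈ Metric.ball (0 : ℂ) 1) :
    ‖g w - g ζ‖ₑ ≤ ∫⁻ s in Set.Ioc (0 : ℝ) 1,
      (‖wdz g (ζ + s * (w - ζ))‖ₑ + ‖wdzbar g (ζ + s * (w - ζ))‖ₑ) * ‖w - ζ‖ₑ := by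
  have hmem : ∀ s ∈ Set.Icc (0 : ℝ) 1, ζ + s * (w - ζ) ∈ U := by
    intro s hs
    rcases hs.1.eq_or_lt with rfl | h0
    · exact hsub (by simp [hζ])
    · exact hsub (Metric.ball_subset_closedBall (add_mul_sub_mem_ball hζ hw ⟨h0, hs.2⟩))
  have hlin : ∀ s : ℝ, HasDerivAt (fun s : ℝ => ζ + s * (w - ζ)) (w - ζ) s := fun s => by
    simpa using ((hasDerivAt_id s).ofReal_comp.mul_const (w - ζ)).const_add ζ
  have hcd : ContDiffOn ℝ 1 (fun s : ℝ => g (ζ + s * (w - ζ))) (Set.Icc 0 1) := by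
    refine hg.comp (ContDiff.contDiffOn ?_) hmem
    exact contDiff_const.add (ofRealCLM.contDiff.mul contDiff_const)
  have := enorm_sub_le_lintegral_deriv_of_contDiffOn_Icc hcd zero_le_one
  rw [← restrict_Ioc_eq_restrict_Icc] at this
  simp only [ofReal_one, one_mul, ofReal_zero, zero_mul, add_zero, add_sub_cancel] at this
  refine this.trans (setLIntegral_mono' measurableSet_Ioc fun s hs => ?_)
  have hd : DifferentiableAt ℝ g (ζ + s * (w - ζ)) :=
    (hg.contDiffAt (hU.mem_nhds (hmem s (Set.Ioc_subset_Icc_self hs)))).differentiableAt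
      one_ne_zero
  have hder : deriv (fun s : ℝ => g (ζ + s * (w - ζ))) s =
      fderiv ℝ g (ζ + s * (w - ζ)) (w - ζ) :=
    (hd.hasFDerivAt.comp_hasDerivAt s (hlin s)).deriv
  rw [hder]
  have := norm_fderiv_apply_le_wdz_add_wdzbar g (ζ + s * (w - ζ)) (w - ζ)
  rw [← ofReal_norm, ← ofReal_norm, ← ofReal_norm, ← ofReal_norm,
    ← ENNReal.ofReal_add (norm_nonneg _) (norm_nonneg _), ← ENNReal.ofReal_mul (by positivity)]
  exact ENNReal.ofReal_le_ofReal this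

/-- Pointwise trace inequality: a `C¹` function is dominated at boundary points of the disc by
the Riesz potential of itself and its first derivatives. -/
theorem enorm_boundary_le_lintegral {g : ℂ → ℂ} {U : Set ℂ} (hU : IsOpen U)
    (hsub : Metric.closedBall (0 : ℂ) 1 ⊆ U) (hg : ContDiffOn ℝ 1 g U) {ζ : ℂ} (hζ : ‖ζ‖ = 1) :
    ‖g ζ‖ₑ ≤ ∫⁻ w in Metric.ball (0 : ℂ) 1,
      ‖ζ - w‖ₑ⁻¹ * (‖g w‖ₑ + ‖wdz g w‖ₑ + ‖wdzbar g w‖ₑ) := by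
  have hgm : AEMeasurable (fun w => ‖g w‖ₑ) (volume.restrict (Metric.ball (0 : ℂ) 1)) :=
    (((hg.continuousOn.mono (Metric.ball_subset_closedBall.trans hsub)).aestronglyMeasurable
      measurableSet_ball).enorm)
  have hFm : Measurable fun w => ‖wdz g w‖ₑ + ‖wdzbar g w‖ₑ :=
    (measurable_wdz g).enorm.add (measurable_wdzbar g).enorm
  set J := ∫⁻ w in Metric.ball (0 : ℂ) 1,
      ‖ζ - w‖ₑ⁻¹ * (‖g w‖ₑ + ‖wdz g w‖ₑ + ‖wdzbar g w‖ₑ) with hJ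
  have h1 : ‖g ζ‖ₑ * ENNReal.ofReal Real.pi ≤ 2 * J := by
    calc ‖g ζ‖ₑ * ENNReal.ofReal Real.pi = ∫⁻ _ in Metric.ball (0 : ℂ) 1, ‖g ζ‖ₑ := by
          rw [setLIntegral_const, Complex.volume_ball]
          simp [ENNReal.ofReal, Real.toNNReal, NNReal.pi, Real.pi_pos.le]
          rfl
      _ ≤ ∫⁻ w in Metric.ball (0 : ℂ) 1, (‖g w‖ₑ + ∫⁻ s in Set.Ioc (0 : ℝ) 1,
            (‖wdz g (ζ + s * (w - ζ))‖ₑ + ‖wdzbar g (ζ + s * (w - ζ))‖ₑ) * ‖w - ζ‖ₑ) := by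
          refine setLIntegral_mono' measurableSet_ball fun w hw => ?_
          calc ‖g ζ‖ₑ = ‖g w - (g w - g ζ)‖ₑ := by rw [sub_sub_cancel]
            _ ≤ ‖g w‖ₑ + ‖g w - g ζ‖ₑ := enorm_sub_le
            _ ≤ _ := by gcongr; exact enorm_sub_le_lintegral_segment hU hsub hg hζ hw
      _ ≤ (∫⁻ w in Metric.ball (0 : ℂ) 1, 2 * (‖ζ - w‖ₑ⁻¹ * ‖g w‖ₑ)) +
            2 * ∫⁻ w in Metric.ball (0 : ℂ) 1, ‖ζ - w‖ₑ⁻¹ * (‖wdz g w‖ₑ + ‖wdzbar g w‖ₑ) := by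
          rw [lintegral_add_left' hgm]
          refine add_le_add (setLIntegral_mono' measurableSet_ball fun w hw => ?_)
            (lintegral_lintegral_segment_le hFm hζ)
          rw [← mul_assoc]
          refine le_mul_of_one_le_left' ?_
          have hle : ‖ζ - w‖ₑ ≤ 2 := by
            rw [← ofReal_norm, ← ENNReal.ofReal_ofNat]
            rw [mem_ball_zero_iff] at hw
            exact ENNReal.ofReal_le_ofReal (by linarith [norm_sub_le ζ w])
          calc (1 : ℝ≥0∞) = 2 * 2⁻¹ := (ENNReal.mul_inv_cancel two_ne_zero (by simp)).symm
            _ ≤ _ := by gcongr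
      _ = 2 * J := by
          rw [lintegral_const_mul' _ _ (by simp), ← mul_add, ← lintegral_add_left' (by fun_prop)]
          simp only [hJ, mul_add, add_assoc]
  have h2 : ‖g ζ‖ₑ * 2 ≤ 2 * J := by
    refine le_trans ?_ h1
    gcongr
    rw [← ENNReal.ofReal_ofNat]
    exact ENNReal.ofReal_le_ofReal Real.two_le_pi
  rw [mul_comm] at h2
  exact (ENNReal.mul_le_mul_iff_right two_ne_zero (by simp)).1 h2

theorem exists_schur_exponents {p l : ℝ} (hp : 2 < p) (hl : 2 * p / (2 + p) < l) :
    ∃ s q : ℝ, 1 < s ∧ s ≤ l ∧ s ≤ q ∧ q ≤ p ∧ 1 / q < 2 / p ∧ 2 / s < 1 + 1 / q := by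
  have hp0 : 0 < p := by linarith
  have h1 : 2 * p / (2 + p) < p / 2 := by
    rw [div_lt_div_iff₀ (by linarith) two_pos]; nlinarith
  have h2 : 1 < 2 * p / (2 + p) := by rw [lt_div_iff₀ (by linarith)]; linarith
  obtain ⟨s, hs1, hs2⟩ := exists_between (lt_min hl h1)
  have hsl := lt_of_lt_of_le hs2 (min_le_left _ _)
  have hsp := lt_of_lt_of_le hs2 (min_le_right _ _)
  have hs0 : 0 < s := by linarith
  have h3 : 2 / s - 1 < 2 / p := by
    rw [div_lt_iff₀ (by linarith)] at hs1
    rw [sub_lt_iff_lt_add, div_lt_iff₀ hs0]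
    have : (2 / p + 1) * s = s * (2 + p) / p := by field_simp
    rw [this, lt_div_iff₀ hp0]
    exact hs1
  have h4 : 1 / p < 2 / p := by gcongr; norm_num
  obtain ⟨x, hx1, hx2⟩ := exists_between (max_lt h3 h4)
  have hxs := lt_of_le_of_lt (le_max_left _ _) hx1
  have hxp := lt_of_le_of_lt (le_max_right _ _) hx1
  have hx0 : 0 < x := lt_trans (by positivity) hxp
  refine ⟨s, 1 / x, by linarith, hsl.le, ?_, ?_, by simpa using hx2, ?_⟩
  · refine hsp.le.trans ?_
    rw [le_div_iff₀ hx0]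
    rw [lt_div_iff₀ hp0] at hx2
    linarith
  · rw [div_le_iff₀ hx0]
    rw [div_lt_iff₀ hp0] at hxp
    linarith
  · rw [one_div_one_div]; linarith

/-- The circle potential of the trace of a `C¹` function is bounded in `L^p` of the disc by the
`L^s` norm of the function and its first derivatives. -/
theorem exists_circle_potential_le {p q s : ℝ} (hs : 1 < s) (hsq : s ≤ q) (hqp : q ≤ p)
    (hq2 : 1 / q < 2 / p) (hs2 : 2 / s < 1 + 1 / q) :
    ∃ M : ℝ≥0∞, M ≠ ∞ ∧ ∀ (g : ℂ → ℂ) (U : Set ℂ), IsOpen U → Metric.closedBall (0 : ℂ) 1 ⊆ U →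
      ContDiffOn ℝ 1 g U →
      (∫⁻ z in Metric.ball (0 : ℂ) 1, (∫⁻ t in Set.Ioc 0 (2 * Real.pi),
        ‖z - exp (I * t)‖ₑ⁻¹ * ‖g (exp (I * t))‖ₑ) ^ p) ^ (1 / p) ≤
      M * (∫⁻ w in Metric.ball (0 : ℂ) 1,
        (‖g w‖ₑ + ‖wdz g w‖ₑ + ‖wdzbar g w‖ₑ) ^ s) ^ (1 / s) := by
  have hs0 : 0 < s := by linarith
  have hq0 : 0 < q := by linarith
  have hp0 : 0 < p := by linarith
  have hd1 : 1 < 1 + 2 / p - 1 / q := by linarith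
  have hd2 : 1 < 1 / q + 2 - 2 / s := by linarith
  set u := 1 / (1 + 2 / p - 1 / q) with hu
  set v := 1 / (1 / q + 2 - 2 / s) with hv
  have hu0 : 0 < u := by positivity
  have hv0 : 0 < v := one_div_pos.2 (by linarith)
  have hu1 : u < 1 := by rw [hu, div_lt_one (by linarith)]; exact hd1
  have hv1 : v < 1 := by rw [hv, div_lt_one (by linarith)]; exact hd2
  have huu : 2 * u / p + u * (1 - 1 / q) = 1 := by
    have h : u * (1 + 2 / p - 1 / q) = 1 := one_div_mul_cancel (by linarith)
    linear_combination h
  have hvv : v / q + 2 * v * (1 - 1 / s) = 1 := by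
    have h : v * (1 / q + 2 - 2 / s) = 1 := one_div_mul_cancel (by linarith)
    linear_combination h
  obtain ⟨B₁, hB₁, hB₁'⟩ := exists_lintegral_ball_enorm_sub_inv_rpow_le (a := 2 * u) (by linarith)
  obtain ⟨A₁, hA₁, hA₁'⟩ := exists_lintegral_circle_enorm_sub_inv_rpow_le (c := u) hu0.le hu1
  obtain ⟨B₂, hB₂, hB₂'⟩ := exists_lintegral_ball_enorm_sub_inv_rpow_le (a := 2 * v) (by linarith)
  obtain ⟨A₂, hA₂, hA₂'⟩ := exists_lintegral_circle_enorm_sub_inv_rpow_le (c := v) hv0.le hv1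
  have hqi : 0 ≤ 1 - 1 / q := by
    rw [sub_nonneg, div_le_one hq0]; linarith
  have hsi : 0 ≤ 1 - 1 / s := by
    rw [sub_nonneg, div_le_one hs0]; linarith
  refine ⟨(B₁ ^ (1 / p) * A₁ ^ (1 - 1 / q)) * (A₂ ^ (1 / q) * B₂ ^ (1 - 1 / s)),
    by finiteness, fun g U hU hsub hg => ?_⟩
  have hcirc : ∀ t : ℝ, ‖exp (I * t)‖ = 1 := fun t => norm_exp_I_mul_ofReal t
  have hφ : Continuous fun t : ℝ => g (exp (I * t)) :=
    hg.continuousOn.comp_continuous (by fun_prop) fun t => hsub (by simp [hcirc])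
  have hgm : AEMeasurable (fun w => ‖g w‖ₑ) (volume.restrict (Metric.ball (0 : ℂ) 1)) :=
    (((hg.continuousOn.mono (Metric.ball_subset_closedBall.trans hsub)).aestronglyMeasurable
      measurableSet_ball).enorm)
  have h1 := lintegral_lintegral_kernel_rpow_le
    (μ := volume.restrict (Metric.ball (0 : ℂ) 1))
    (ν := volume.restrict (Set.Ioc 0 (2 * Real.pi)))
    (k := fun z t => ‖z - exp (I * t)‖ₑ⁻¹) (f := fun t : ℝ => ‖g (exp (I * t))‖ₑ)
    (Measurable.inv (by fun_prop)) hφ.measurable.enorm.aemeasurable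
    (by linarith) hqp (by positivity) hu0.le huu
    (ae_of_all _ hA₁') (ae_of_all _ fun t => hB₁' _ (hcirc t))
  have h2 := lintegral_lintegral_kernel_rpow_le
    (μ := volume.restrict (Set.Ioc 0 (2 * Real.pi)))
    (ν := volume.restrict (Metric.ball (0 : ℂ) 1))
    (k := fun (t : ℝ) w => ‖exp (I * t) - w‖ₑ⁻¹)
    (f := fun w => ‖g w‖ₑ + ‖wdz g w‖ₑ + ‖wdzbar g w‖ₑ)
    (Measurable.inv (by fun_prop))
    ((hgm.add (measurable_wdz g).enorm.aemeasurable).add (measurable_wdzbar g).enorm.aemeasurable)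
    hs.le hsq hv0.le (by positivity) hvv (A := B₂) (B := A₂)
    (ae_of_all _ fun t => by
      simpa only [enorm_sub_rev] using hB₂' _ (hcirc t))
    (ae_of_all _ fun w => by
      simpa only [enorm_sub_rev] using hA₂' w)
  refine h1.trans ?_
  rw [mul_assoc (B₁ ^ (1 / p) * A₁ ^ (1 - 1 / q))]
  gcongr
  refine le_trans ?_ h2
  gcongr with t
  exact enorm_boundary_le_lintegral hU hsub hg (hcirc t)

theorem enorm_circle_integral_le (n : ℝ) (z₀ z : ℂ) (g : ℂ → ℂ) :
    ‖(1 / (2 * (Real.pi : ℂ))) * ∫ t in (0 : ℝ)..(2 * Real.pi),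
        Complex.exp (-Complex.I * (n : ℂ) *
            ((Complex.exp (Complex.I * (t : ℂ)) - z₀) ^ 2 +
             ((starRingEnd ℂ) (Complex.exp (Complex.I * (t : ℂ)) - z₀)) ^ 2)) *
          g (Complex.exp (Complex.I * (t : ℂ))) *
          (z - Complex.exp (Complex.I * (t : ℂ)))⁻¹ *
          Complex.exp (Complex.I * (t : ℂ))‖ₑ ≤
      ∫⁻ t in Set.Ioc 0 (2 * Real.pi), ‖z - exp (I * t)‖ₑ⁻¹ * ‖g (exp (I * t))‖ₑ := by
  rw [enorm_mul]
  have hpi : ‖1 / (2 * (Real.pi : ℂ))‖ₑ ≤ 1 := by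
    rw [← ofReal_norm, ← ENNReal.ofReal_one]
    refine ENNReal.ofReal_le_ofReal ?_
    rw [norm_div, norm_one, norm_mul, norm_real, Real.norm_of_nonneg Real.pi_pos.le,
      Complex.norm_ofNat]
    rw [div_le_one (by positivity)]
    linarith [Real.two_le_pi]
  refine (mul_le_of_le_one_left' hpi).trans ?_
  rw [intervalIntegral.integral_of_le Real.two_pi_pos.le]
  refine (enorm_integral_le_lintegral_enorm _).trans (lintegral_mono fun t => ?_)
  have hexp : ∀ w : ℂ, ‖exp (-I * n * (w ^ 2 + ((starRingEnd ℂ) w) ^ 2))‖ₑ = 1 := fun w => by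
    have : -I * n * (w ^ 2 + ((starRingEnd ℂ) w) ^ 2) =
        I * ((-(n * (2 * (w ^ 2).re)) : ℝ) : ℂ) := by
      rw [← map_pow, add_conj]; push_cast; ring
    rw [this, ← ofReal_norm, norm_exp_I_mul_ofReal, ENNReal.ofReal_one]
  have hexp' : ‖exp (I * t)‖ₑ = 1 := by
    rw [← ofReal_norm, norm_exp_I_mul_ofReal, ENNReal.ofReal_one]
  rw [enorm_mul, enorm_mul, enorm_mul, hexp, hexp', one_mul, mul_one, mul_comm]
  gcongr
  by_cases h : z - exp (I * t) = 0
  · simp [h]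
  · rw [enorm_inv h]

instance isFiniteMeasure_restrict_unit_ball :
    IsFiniteMeasure (volume.restrict (Metric.ball (0 : ℂ) 1)) :=
  ⟨by rw [Measure.restrict_apply_univ]; exact measure_ball_lt_top⟩

theorem eLpNorm_ne_top_of_continuousOn_closedBall {f : ℂ → ℂ}
    (hf : ContinuousOn f (Metric.closedBall 0 1)) (l : ℝ≥0∞) :
    eLpNorm f l (volume.restrict (Metric.ball (0 : ℂ) 1)) ≠ ∞ := by
  obtain ⟨c, hc⟩ := (isCompact_closedBall (0 : ℂ) 1).exists_bound_of_continuousOn hf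
  have : MemLp f l (volume.restrict (Metric.ball (0 : ℂ) 1)) :=
    MemLp.of_bound ((hf.mono Metric.ball_subset_closedBall).aestronglyMeasurable
      measurableSet_ball) c (by
        filter_upwards [ae_restrict_mem measurableSet_ball] with x hx
        exact hc x (Metric.ball_subset_closedBall hx))
  exact this.eLpNorm_ne_top

/-- Boundary integral estimate: for `2 < p < ∞`, `r > 0`, `l = (2+r)p/(2+p)`, `n > 1` and
`z₀ ∈ Ω`, `‖(1/2π) ∫_{∂Ω} e^{-inR(z',z₀)} g(z') (z-z')⁻¹ z' dσ(z')‖_{L^p(Ω)}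
  ≤ C_{r,p} n^{(1-2/((1+r)p))(1-2/(2+r))} ‖g‖_{W^{1,l}(Ω)}`,
where the circle `∂Ω` is parametrized by `t ↦ e^{it}`, `t ∈ [0, 2π]`, so that `dσ = dt`. -/
theorem stmt_8 (p r : ℝ) (hp : 2 < p) (hr : 0 < r) :
    ∃ C : ℝ, 0 ≤ C ∧ ∀ n : ℝ, 1 < n → ∀ z₀ ∈ Metric.ball (0 : ℂ) 1,
      ∀ g : ℂ → ℂ,
        (∃ U : Set ℂ, IsOpen U ∧ Metric.closedBall (0 : ℂ) 1 ⊆ U ∧ ContDiffOn ℝ 1 g U) →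
        (eLpNorm (fun z : ℂ =>
            (1 / (2 * (Real.pi : ℂ))) * ∫ t in (0 : ℝ)..(2 * Real.pi),
              Complex.exp (-Complex.I * (n : ℂ) *
                  ((Complex.exp (Complex.I * (t : ℂ)) - z₀) ^ 2 +
                   ((starRingEnd ℂ) (Complex.exp (Complex.I * (t : ℂ)) - z₀)) ^ 2)) *
                g (Complex.exp (Complex.I * (t : ℂ))) *
                (z - Complex.exp (Complex.I * (t : ℂ)))⁻¹ *
                Complex.exp (Complex.I * (t : ℂ)))
          (ENNReal.ofReal p) (volume.restrict (Metric.ball (0 : ℂ) 1))).toReal ≤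
        C * n ^ ((1 - 2 / ((1 + r) * p)) * (1 - 2 / (2 + r))) *
          W1Norm g ((2 + r) * p / (2 + p)) := by
  have hl : 2 * p / (2 + p) < (2 + r) * p / (2 + p) := by
    gcongr; linarith
  obtain ⟨s, q, hs1, hsl, hsq, hqp, hq2, hs2⟩ := exists_schur_exponents hp hl
  obtain ⟨M, hM, hMg⟩ := exists_circle_potential_le hs1 hsq hqp hq2 hs2
  set l := (2 + r) * p / (2 + p) with hldef
  set Ω : Set ℂ := Metric.ball 0 1 with hΩ
  have hs0 : 0 < s := by linarith
  set K : ℝ≥0∞ := (volume.restrict Ω) Set.univ ^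
    (1 / (ENNReal.ofReal s).toReal - 1 / (ENNReal.ofReal l).toReal) with hK
  have hKfin : K ≠ ∞ := by
    refine ENNReal.rpow_ne_top_of_nonneg ?_ (measure_ne_top _ _)
    rw [ENNReal.toReal_ofReal hs0.le, ENNReal.toReal_ofReal (by linarith), sub_nonneg]
    exact one_div_le_one_div_of_le hs0 hsl
  refine ⟨(M * K).toReal, ENNReal.toReal_nonneg, ?_⟩
  rintro n hn z₀ - g ⟨U, hU, hsub, hg⟩
  have hfd : ContinuousOn (fderiv ℝ g) (Metric.closedBall 0 1) :=
    (hg.continuousOn_fderiv_of_isOpen hU le_rfl).mono hsub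
  have hg0 : ContinuousOn g (Metric.closedBall 0 1) := hg.continuousOn.mono hsub
  have hg1 : ContinuousOn (wdz g) (Metric.closedBall 0 1) := by unfold wdz; fun_prop
  have hg2 : ContinuousOn (wdzbar g) (Metric.closedBall 0 1) := by unfold wdzbar; fun_prop
  have hfin := fun {f : ℂ → ℂ} (hf : ContinuousOn f (Metric.closedBall 0 1)) =>
    eLpNorm_ne_top_of_continuousOn_closedBall hf (ENNReal.ofReal l)
  have hmeas : ∀ {f : ℂ → ℂ}, ContinuousOn f (Metric.closedBall 0 1) →
      AEStronglyMeasurable f (volume.restrict Ω) := fun hf =>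
    (hf.mono Metric.ball_subset_closedBall).aestronglyMeasurable measurableSet_ball
  have hle : ∀ {f : ℂ → ℂ}, ContinuousOn f (Metric.closedBall 0 1) →
      eLpNorm f (ENNReal.ofReal s) (volume.restrict Ω) ≤
        eLpNorm f (ENNReal.ofReal l) (volume.restrict Ω) * K := fun hf =>
    eLpNorm_le_eLpNorm_mul_rpow_measure_univ (ENNReal.ofReal_le_ofReal hsl) (hmeas hf)
  have hnorm : (∫⁻ w in Ω, (‖g w‖ₑ + ‖wdz g w‖ₑ + ‖wdzbar g w‖ₑ) ^ s) ^ (1 / s) ≤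
      K * (eLpNorm g (ENNReal.ofReal l) (volume.restrict Ω) +
        eLpNorm (wdz g) (ENNReal.ofReal l) (volume.restrict Ω) +
        eLpNorm (wdzbar g) (ENNReal.ofReal l) (volume.restrict Ω)) := by
    have hval : ∀ f : ℂ → ℂ, eLpNorm f (ENNReal.ofReal s) (volume.restrict Ω) =
        (∫⁻ w in Ω, ‖f w‖ₑ ^ s) ^ (1 / s) := fun f => by
      rw [eLpNorm_eq_lintegral_rpow_enorm_toReal (by simpa using hs0) ENNReal.ofReal_ne_top,
        ENNReal.toReal_ofReal hs0.le]
    calc _ ≤ (∫⁻ w in Ω, (‖g w‖ₑ + ‖wdz g w‖ₑ) ^ s) ^ (1 / s) +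
            (∫⁻ w in Ω, ‖wdzbar g w‖ₑ ^ s) ^ (1 / s) :=
          ENNReal.lintegral_Lp_add_le ((hmeas hg0).enorm.add (hmeas hg1).enorm)
            (hmeas hg2).enorm hs1.le
      _ ≤ (∫⁻ w in Ω, ‖g w‖ₑ ^ s) ^ (1 / s) + (∫⁻ w in Ω, ‖wdz g w‖ₑ ^ s) ^ (1 / s) +
            (∫⁻ w in Ω, ‖wdzbar g w‖ₑ ^ s) ^ (1 / s) := by
          gcongr
          exact ENNReal.lintegral_Lp_add_le (hmeas hg0).enorm (hmeas hg1).enorm hs1.le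
      _ ≤ _ := by
          rw [← hval, ← hval, ← hval, mul_add, mul_add, mul_comm K, mul_comm K, mul_comm K]
          exact add_le_add (add_le_add (hle hg0) (hle hg1)) (hle hg2)
  have hp0 : 0 < p := by linarith
  have hW : (eLpNorm g (ENNReal.ofReal l) (volume.restrict Ω) +
        eLpNorm (wdz g) (ENNReal.ofReal l) (volume.restrict Ω) +
        eLpNorm (wdzbar g) (ENNReal.ofReal l) (volume.restrict Ω)).toReal = W1Norm g l := by
    rw [ENNReal.toReal_add (ENNReal.add_ne_top.2 ⟨hfin hg0, hfin hg1⟩) (hfin hg2),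
      ENNReal.toReal_add (hfin hg0) (hfin hg1)]
    rfl
  have hn1 : 1 ≤ n ^ ((1 - 2 / ((1 + r) * p)) * (1 - 2 / (2 + r))) := by
    refine Real.one_le_rpow hn.le (mul_nonneg ?_ ?_)
    · rw [sub_nonneg, div_le_one (by positivity)]; nlinarith
    · rw [sub_nonneg, div_le_one (by positivity)]; linarith
  have hW0 : 0 ≤ W1Norm g l := hW ▸ ENNReal.toReal_nonneg
  calc _ ≤ (M * K * (eLpNorm g (ENNReal.ofReal l) (volume.restrict Ω) +
        eLpNorm (wdz g) (ENNReal.ofReal l) (volume.restrict Ω) +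
        eLpNorm (wdzbar g) (ENNReal.ofReal l) (volume.restrict Ω))).toReal := by
        refine ENNReal.toReal_mono (ENNReal.mul_ne_top (ENNReal.mul_ne_top hM hKfin)
          (ENNReal.add_ne_top.2 ⟨ENNReal.add_ne_top.2 ⟨hfin hg0, hfin hg1⟩, hfin hg2⟩)) ?_
        rw [eLpNorm_eq_lintegral_rpow_enorm_toReal (by simpa using hp0) ENNReal.ofReal_ne_top,
          ENNReal.toReal_ofReal hp0.le, mul_assoc]
        refine le_trans ?_ ((hMg g U hU hsub hg).trans (by gcongr))
        gcongr with z
        exact enorm_circle_integral_le n z₀ z g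
    _ = (M * K).toReal * W1Norm g l := by rw [ENNReal.toReal_mul, hW]
    _ ≤ _ := by
        gcongr
        exact le_mul_of_one_le_right ENNReal.toReal_nonneg hn1
end

section
/- Let n be a nonzero real number, z₀ ∈ Ω, and let g be continuously differentiable on a neighbourhood of the closed unit disc and vanish on a neighbourhood of z₀. Then for almost every z ∈ Ω one has (1/π) ∫_Ω e^{−inR(z',z₀)} g(z') (z − z')^{−1} dm(z') = (−1/(2in)) [ e^{−inR(z,z₀)} g(z)/(z̄ − z̄₀) − (1/π) ∫_Ω e^{−inR(z',z₀)} ∂̄_{z'} ( g(z')/(z̄' − z̄₀) ) (z − z')^{−1} dm(z') + (1/2π) ∫_{∂Ω} e^{−inR(z',z₀)} g(z') ((z − z')(z̄' − z̄₀))^{−1} z' dσ(z') ], where σ is arclength measure on the unit circle ∂Ω. -/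
open Complex MeasureTheory

/-- The phase `R(z,z₀) = (z-z₀)² + (z̄-z̄₀)²`. -/
noncomputable def phaseR (z z₀ : ℂ) : ℂ :=
  (z - z₀) ^ 2 + ((starRingEnd ℂ) (z - z₀)) ^ 2

lemma hasFDerivAt_polar (p : ℝ × ℝ) :
    HasFDerivAt (fun q : ℝ × ℝ => (q.1 : ℂ) * exp (q.2 * I))
      (exp (p.2 * I) • (ofRealCLM ∘L ContinuousLinearMap.fst ℝ ℝ ℝ) +
        (I * (p.1 * exp (p.2 * I))) • (ofRealCLM ∘L ContinuousLinearMap.snd ℝ ℝ ℝ)) p := by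
  have h1 : HasFDerivAt (fun q : ℝ × ℝ => (q.1 : ℂ))
      (ofRealCLM ∘L ContinuousLinearMap.fst ℝ ℝ ℝ) p :=
    (ofRealCLM ∘L ContinuousLinearMap.fst ℝ ℝ ℝ).hasFDerivAt
  have h2 : HasFDerivAt (fun q : ℝ × ℝ => (q.2 : ℂ))
      (ofRealCLM ∘L ContinuousLinearMap.snd ℝ ℝ ℝ) p :=
    (ofRealCLM ∘L ContinuousLinearMap.snd ℝ ℝ ℝ).hasFDerivAt
  refine (h1.mul (h2.mul_const I).cexp).congr_fderiv ?_
  ext <;> simp [mul_comm, mul_left_comm]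

lemma map_eq_re_mul_add_im_mul (L : ℂ →L[ℝ] ℂ) (w : ℂ) :
    L w = w.re * L 1 + w.im * L I := by
  conv_lhs => rw [show w = w.re • (1 : ℂ) + w.im • I by simp [re_add_im]]
  rw [map_add, map_smul, map_smul, real_smul, real_smul]

lemma polar_jacobian_wdzbar (L : ℂ →L[ℝ] ℂ) (r θ : ℝ) :
    I * (r * exp (θ * I)) * L (exp (θ * I)) - exp (θ * I) * L (I * (r * exp (θ * I))) =
      r * (2 * I * ((L 1 + I * L I) / 2)) := by
  have h1 : exp (θ * I) = Real.cos θ + Real.sin θ * I := by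
    rw [exp_mul_I, ofReal_cos, ofReal_sin]
  have h2 : I * (r * exp (θ * I)) =
      ((-(r * Real.sin θ) : ℝ) : ℂ) + ((r * Real.cos θ : ℝ) : ℂ) * I := by
    rw [h1]; push_cast; linear_combination (r * Complex.sin θ) * I_sq
  have h3 : (Real.cos θ : ℂ) ^ 2 + (Real.sin θ : ℂ) ^ 2 = 1 := by
    exact_mod_cast Real.cos_sq_add_sin_sq θ
  rw [map_eq_re_mul_add_im_mul L (exp (θ * I)), map_eq_re_mul_add_im_mul L (I * (r * exp (θ * I))),
    h2, h1]
  simp only [add_re, add_im, ofReal_re, ofReal_im, mul_re, mul_im, I_re, I_im, mul_zero, mul_one,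
    sub_zero, zero_add, add_zero]
  push_cast at h3 ⊢
  generalize Complex.cos θ = c at *
  generalize Complex.sin θ = s at *
  linear_combination (I * r * L 1 - r * L I) * h3 - r * L I * I_sq

lemma continuousOn_wdzbar {F : ℂ → ℂ} {U : Set ℂ} (hU : IsOpen U) (hF : ContDiffOn ℝ 1 F U) :
    ContinuousOn (wdzbar F) U := by
  have h := hF.continuousOn_fderiv_of_isOpen hU le_rfl
  unfold wdzbar
  fun_prop

lemma setIntegral_unitBall_eq_polar (u : ℂ → ℂ) :
    ∫ w in Metric.ball (0 : ℂ) 1, u w =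
      ∫ p in Set.Ioo (0 : ℝ) 1 ×ˢ Set.Ioo (-Real.pi) Real.pi, (p.1 : ℂ) * u (p.1 * exp (p.2 * I)) := by
  rw [← integral_indicator Metric.isOpen_ball.measurableSet, ← Complex.integral_comp_polarCoord_symm,
    ← integral_indicator polarCoord.open_target.measurableSet,
    ← integral_indicator (measurableSet_Ioo.prod measurableSet_Ioo)]
  congr 1
  ext p
  have hp : Complex.polarCoord.symm p = p.1 * exp (p.2 * I) := by
    rw [Complex.polarCoord_symm_apply, exp_mul_I, ofReal_cos, ofReal_sin]
  simp only [Set.indicator_apply, polarCoord_target, Set.mem_prod, Set.mem_Ioi, Set.mem_Ioo,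
    hp, real_smul]
  by_cases h0 : 0 < p.1 <;> by_cases h1 : p.1 < 1 <;>
    by_cases h2 : -Real.pi < p.2 ∧ p.2 < Real.pi <;> simp [h0, h1, h2, abs_of_pos]

/-- Green's formula in complex form on the unit disc. -/
lemma circleIntegral_eq_integral_wdzbar {F : ℂ → ℂ} {U : Set ℂ} (hU : IsOpen U)
    (hUb : Metric.closedBall (0 : ℂ) 1 ⊆ U) (hF : ContDiffOn ℝ 1 F U) :
    (∮ w in C(0, 1), F w) = 2 * I * ∫ w in Metric.ball (0 : ℂ) 1, wdzbar F w := by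
  set P : ℝ × ℝ → ℂ := fun q => (q.1 : ℂ) * exp (q.2 * I) with hP
  have hPc : Continuous P := by fun_prop
  have hPn : ∀ q, ‖P q‖ = |q.1| := fun q => by
    rw [hP, norm_mul, norm_exp_ofReal_mul_I, mul_one, norm_real, Real.norm_eq_abs]
  have hpi : -Real.pi ≤ Real.pi := by linarith [Real.pi_pos]
  set S : Set (ℝ × ℝ) := Set.uIcc 0 1 ×ˢ Set.uIcc (-Real.pi) Real.pi
  have hSc : IsCompact S := isCompact_uIcc.prod isCompact_uIcc
  have hPm : Set.MapsTo P S U := by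
    rintro q ⟨hq, -⟩
    rw [Set.uIcc_of_le zero_le_one] at hq
    exact hUb (by rw [mem_closedBall_zero_iff, hPn, abs_of_nonneg hq.1]; exact hq.2)
  have hFc : ContinuousOn (fun q => F (P q)) S := hF.continuousOn.comp hPc.continuousOn hPm
  have hWc : ContinuousOn (fun q => wdzbar F (P q)) S :=
    (continuousOn_wdzbar hU hF).comp hPc.continuousOn hPm
  have hd : ∀ q ∈ S, HasFDerivAt (fun q => F (P q)) _ q := fun q hq =>
    (((hF.differentiableOn one_ne_zero).differentiableAt (hU.mem_nhds (hPm hq))).hasFDerivAt).comp q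
      (hasFDerivAt_polar q)
  have he : ∀ q : ℝ × ℝ, HasFDerivAt (fun q : ℝ × ℝ => exp (q.2 * I)) _ q := fun q =>
    (((ofRealCLM ∘L ContinuousLinearMap.snd ℝ ℝ ℝ).hasFDerivAt (x := q)).mul_const I).cexp
  have hsub : Set.Ioo (min 0 1) (max 0 1) ×ˢ
      Set.Ioo (min (-Real.pi) Real.pi) (max (-Real.pi) Real.pi) ⊆ S :=
    Set.prod_mono Set.Ioo_subset_Icc_self Set.Ioo_subset_Icc_self
  have hdiv : ∀ q : ℝ × ℝ, _ = (q.1 : ℂ) * (2 * I * wdzbar F (P q)) := fun q =>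
    polar_jacobian_wdzbar (fderiv ℝ F (P q)) q.1 q.2
  have hI : IntegrableOn (fun q : ℝ × ℝ => (q.1 : ℂ) * (2 * I * wdzbar F (P q))) S := by
    refine ContinuousOn.integrableOn_compact hSc ?_
    fun_prop
  have key := integral2_divergence_prod_of_hasFDerivAt_off_countable
    (fun q => F (P q) * (I * P q)) (fun q => -(F (P q) * exp (q.2 * I))) _ _ 0 (-Real.pi) 1 Real.pi
    ∅ Set.countable_empty (hFc.mul (by fun_prop)) (hFc.mul (by fun_prop)).neg
    (fun q hq => (hd q (hsub hq.1)).mul ((hasFDerivAt_polar q).const_mul I))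
    (fun q hq => ((hd q (hsub hq.1)).mul (he q)).neg)
    (by
      refine hI.congr_fun (fun q _ => ?_) hSc.measurableSet
      refine (hdiv q).symm.trans ?_
      simp [hP]
      ring)
  have hL : (∫ x in (0 : ℝ)..1, ∫ y in (-Real.pi)..Real.pi,
      (x : ℂ) * (2 * I * wdzbar F (P (x, y)))) =
      2 * I * ∫ w in Metric.ball (0 : ℂ) 1, wdzbar F w := by
    rw [setIntegral_unitBall_eq_polar, ← integral_const_mul, Measure.volume_eq_prod,
      setIntegral_prod _ ?_]
    · simp_rw [intervalIntegral.integral_of_le zero_le_one, intervalIntegral.integral_of_le hpi,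
        integral_Ioc_eq_integral_Ioo]
      refine integral_congr_ae (.of_forall fun x => integral_congr_ae (.of_forall fun y => ?_))
      simp only [hP]
      ring
    · refine (hI.mono_set (Set.prod_mono ?_ ?_)).congr (.of_forall fun x => ?_)
      · rw [Set.uIcc_of_le zero_le_one]; exact Set.Ioo_subset_Icc_self
      · rw [Set.uIcc_of_le hpi]; exact Set.Ioo_subset_Icc_self
      · simp only [hP]
        ring
  have hexp : exp ((Real.pi : ℂ) * I) = exp (((-Real.pi : ℝ) : ℂ) * I) := by
    rw [ofReal_neg, neg_mul, exp_neg, exp_pi_mul_I]; norm_num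
  rw [← hL, circleIntegral]
  calc _ = ∫ y in (-Real.pi)..Real.pi, F (P (1, y)) * (I * P (1, y)) := by
        have hper : Function.Periodic (fun θ => deriv (circleMap 0 1) θ • F (circleMap 0 1 θ))
            (2 * Real.pi) := fun θ => by
          simp [periodic_circleMap 0 1 θ]
        have := hper.intervalIntegral_add_eq 0 (-Real.pi)
        rw [zero_add, show -Real.pi + 2 * Real.pi = Real.pi by ring] at this
        rw [this]
        refine intervalIntegral.integral_congr fun y _ => ?_
        simp only [hP, deriv_circleMap, circleMap_zero, smul_eq_mul]
        ring
    _ = _ := by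
        refine Eq.trans ?_ (key.symm.trans ?_)
        · simp [hP, hexp]
        · refine intervalIntegral.integral_congr fun x _ =>
            intervalIntegral.integral_congr fun y _ => ?_
          refine Eq.trans ?_ (hdiv (x, y))
          simp [hP]
          ring

lemma wdzbar_mul {f g : ℂ → ℂ} {z : ℂ} (hf : DifferentiableAt ℝ f z)
    (hg : DifferentiableAt ℝ g z) :
    wdzbar (fun w => f w * g w) z = wdzbar f z * g z + f z * wdzbar g z := by
  simp only [wdzbar, fderiv_fun_mul hf hg, _root_.add_apply,
    _root_.smul_apply, smul_eq_mul]
  ring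

lemma hasFDerivAt_conj_sub (z w : ℂ) :
    HasFDerivAt (fun w => (starRingEnd ℂ) (w - z)) (conjCLE : ℂ →L[ℝ] ℂ) w := by
  have h := ((conjCLE : ℂ →L[ℝ] ℂ).hasFDerivAt (x := w)).sub_const ((starRingEnd ℂ) z)
  simpa using h

lemma contDiff_conj_sub (z : ℂ) : ContDiff ℝ 1 fun w => (starRingEnd ℂ) (w - z) :=
  (conjCLE : ℂ →L[ℝ] ℂ).contDiff.comp (contDiff_id.sub contDiff_const)

lemma wdzbar_conj_sub (z w : ℂ) : wdzbar (fun w => (starRingEnd ℂ) (w - z)) w = 1 := by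
  rw [wdzbar, (hasFDerivAt_conj_sub z w).fderiv]
  simp

lemma norm_wdzbar_le (F : ℂ → ℂ) (w : ℂ) : ‖wdzbar F w‖ ≤ ‖fderiv ℝ F w‖ := by
  have h1 := (fderiv ℝ F w).le_opNorm 1
  have h2 := (fderiv ℝ F w).le_opNorm I
  have h3 := norm_add_le (fderiv ℝ F w 1) (I * fderiv ℝ F w I)
  simp only [norm_mul, norm_I, one_mul, norm_one, mul_one] at h1 h2 h3
  rw [wdzbar, norm_div, RCLike.norm_ofNat]
  linarith

lemma integrableOn_unitBall_inv_norm_sub (z : ℂ) :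
    IntegrableOn (fun w => ‖w - z‖⁻¹) (Metric.ball (0 : ℂ) 1) := by
  have h : LocallyIntegrable (fun w : ℂ => ‖w‖⁻¹) := by
    refine locallyIntegrable_of_norm_le_rpow (C := 1) (α := 1) (by simp) (by simp)
      (.of_forall fun w => ?_) (by fun_prop)
    simp [Real.rpow_neg_one]
  have h2 := h.integrableOn_isCompact (isCompact_closedBall (0 : ℂ) (1 + ‖z‖))
  rw [← integrable_indicator_iff measurableSet_closedBall] at h2
  refine (h2.comp_sub_right z).integrableOn (s := Metric.ball 0 1) |>.congr_fun (fun w hw => ?_)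
    measurableSet_ball
  refine Set.indicator_of_mem ?_ _
  rw [mem_ball_zero_iff] at hw
  rw [mem_closedBall_zero_iff]
  linarith [norm_sub_le w z]

lemma integrableOn_mul_inv_sub {φ : ℂ → ℂ} (hφ : ContinuousOn φ (Metric.closedBall 0 1)) (z : ℂ) :
    IntegrableOn (fun w => φ w * (z - w)⁻¹) (Metric.ball (0 : ℂ) 1) := by
  obtain ⟨C, hC⟩ := (isCompact_closedBall (0 : ℂ) 1).exists_bound_of_continuousOn hφ
  refine ((integrableOn_unitBall_inv_norm_sub z).const_mul C).mono' ?_ ?_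
  · exact ((hφ.mono Metric.ball_subset_closedBall).aestronglyMeasurable measurableSet_ball).mul
      (by fun_prop : Measurable fun w : ℂ => (z - w)⁻¹).aestronglyMeasurable
  · refine ae_restrict_of_forall_mem measurableSet_ball fun w hw => ?_
    rw [norm_mul, norm_inv, norm_sub_rev]
    gcongr
    exact hC w (Metric.ball_subset_closedBall hw)

/-- The regularization `conj (w - z) / (|w - z|² + δ)` of the Cauchy kernel `1 / (w - z)`. -/
noncomputable def regKernel (z : ℂ) (δ : ℝ) (w : ℂ) : ℂ :=
  (starRingEnd ℂ) (w - z) * ((w - z) * (starRingEnd ℂ) (w - z) + δ)⁻¹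

lemma regKernel_denom (z w : ℂ) (δ : ℝ) :
    (w - z) * (starRingEnd ℂ) (w - z) + δ = ((‖w - z‖ ^ 2 + δ : ℝ) : ℂ) := by
  rw [mul_conj']; push_cast; rfl

lemma regKernel_denom_ne_zero (z w : ℂ) {δ : ℝ} (hδ : 0 < δ) :
    (w - z) * (starRingEnd ℂ) (w - z) + δ ≠ 0 := by
  rw [regKernel_denom, ofReal_ne_zero]; positivity

lemma contDiff_regKernel_denom (z : ℂ) (δ : ℝ) :
    ContDiff ℝ 1 fun w : ℂ => (w - z) * (starRingEnd ℂ) (w - z) + δ :=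
  ((contDiff_id.sub contDiff_const).mul (contDiff_conj_sub z)).add contDiff_const

lemma contDiff_regKernel (z : ℂ) {δ : ℝ} (hδ : 0 < δ) : ContDiff ℝ 1 (regKernel z δ) :=
  (contDiff_conj_sub z).mul
    ((contDiff_regKernel_denom z δ).inv fun w => regKernel_denom_ne_zero z w hδ)

lemma wdzbar_regKernel (z w : ℂ) {δ : ℝ} (hδ : 0 < δ) :
    wdzbar (regKernel z δ) w = ((δ / (‖w - z‖ ^ 2 + δ) ^ 2 : ℝ) : ℂ) := by
  have hD := contDiff_regKernel_denom z δ
  have h0 := regKernel_denom_ne_zero z w hδ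
  have hmul : (fun w => regKernel z δ w * ((w - z) * (starRingEnd ℂ) (w - z) + δ)) =
      fun w => (starRingEnd ℂ) (w - z) := by
    ext w
    rw [regKernel, inv_mul_cancel_right₀ (regKernel_denom_ne_zero z w hδ)]
  have h1 := wdzbar_mul ((contDiff_regKernel z hδ).differentiable one_ne_zero w)
    (hD.differentiable one_ne_zero w)
  have h2 : wdzbar (fun w : ℂ => (w - z) * (starRingEnd ℂ) (w - z) + δ) w = w - z := by
    have : HasFDerivAt (fun w : ℂ => (w - z) * (starRingEnd ℂ) (w - z) + δ) _ w :=
      (((hasFDerivAt_id (𝕜 := ℝ) w).sub_const z).mul (hasFDerivAt_conj_sub z w)).add_const (δ : ℂ)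
    rw [wdzbar, this.fderiv]
    simp
    linear_combination ((starRingEnd ℂ) w - (starRingEnd ℂ) z - (w - z)) / 2 * I_sq
  rw [hmul, wdzbar_conj_sub, h2] at h1
  rw [ofReal_div, ofReal_pow, ← regKernel_denom, eq_div_iff (pow_ne_zero 2 h0)]
  have h3 := congrFun hmul w
  linear_combination (-((w - z) * (starRingEnd ℂ) (w - z) + δ)) * h1 - (w - z) * h3

lemma norm_regKernel (z w : ℂ) {δ : ℝ} (hδ : 0 < δ) :
    ‖regKernel z δ w‖ = ‖w - z‖ / (‖w - z‖ ^ 2 + δ) := by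
  rw [regKernel, regKernel_denom, norm_mul, norm_inv, norm_real, RCLike.norm_conj,
    Real.norm_of_nonneg (by positivity), div_eq_mul_inv]

lemma norm_regKernel_le (z w : ℂ) {δ : ℝ} (hδ : 0 < δ) : ‖regKernel z δ w‖ ≤ ‖w - z‖⁻¹ := by
  rw [norm_regKernel z w hδ]
  rcases eq_or_ne (w - z) 0 with h | h
  · simp [h]
  · have := norm_pos_iff.mpr h
    rw [div_le_iff₀ (by positivity)]
    field_simp
    linarith

lemma norm_sub_mul_wdzbar_regKernel_le (z w : ℂ) {δ : ℝ} (hδ : 0 < δ) :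
    ‖w - z‖ * ‖wdzbar (regKernel z δ) w‖ ≤ ‖w - z‖⁻¹ := by
  refine le_trans ?_ (norm_regKernel_le z w hδ)
  rw [wdzbar_regKernel z w hδ, norm_real, Real.norm_of_nonneg (by positivity),
    norm_regKernel z w hδ, div_eq_mul_inv ‖w - z‖]
  gcongr
  rw [div_le_iff₀ (by positivity), sq (_ + δ), inv_mul_cancel_left₀ (by positivity)]
  linarith [sq_nonneg ‖w - z‖]

lemma tendsto_regKernel (z w : ℂ) :
    Filter.Tendsto (fun δ => regKernel z δ w) (nhdsWithin 0 (Set.Ioi 0)) (nhds (w - z)⁻¹) := by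
  refine Filter.Tendsto.mono_left ?_ nhdsWithin_le_nhds
  rcases eq_or_ne (w - z) 0 with h | h
  · simp [regKernel, h]
  · have hc : (starRingEnd ℂ) (w - z) ≠ 0 := (map_ne_zero _).mpr h
    have : ContinuousAt (fun δ : ℝ => regKernel z δ w) 0 := by
      unfold regKernel
      refine continuousAt_const.mul (ContinuousAt.inv₀ (by fun_prop) ?_)
      rw [ofReal_zero, add_zero]
      exact mul_ne_zero h hc
    convert this.tendsto using 2
    simp only [regKernel, ofReal_zero, add_zero]
    field_simp

lemma tendsto_wdzbar_regKernel {z w : ℂ} (h : w ≠ z) :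
    Filter.Tendsto (fun δ => wdzbar (regKernel z δ) w) (nhdsWithin 0 (Set.Ioi 0)) (nhds 0) := by
  have : ContinuousAt (fun δ : ℝ => ((δ / (‖w - z‖ ^ 2 + δ) ^ 2 : ℝ) : ℂ)) 0 := by
    refine continuous_ofReal.continuousAt.comp (continuousAt_id.div (by fun_prop) ?_)
    simpa [sub_eq_zero] using h
  have h2 := this.tendsto.mono_left (nhdsWithin_le_nhds (s := Set.Ioi 0))
  rw [zero_div, ofReal_zero] at h2
  refine h2.congr' ?_
  filter_upwards [self_mem_nhdsWithin] with δ hδ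
  exact (wdzbar_regKernel z w hδ).symm

lemma exists_lipschitz_bound {F : ℂ → ℂ} {U : Set ℂ} (hU : IsOpen U)
    (hUb : Metric.closedBall (0 : ℂ) 1 ⊆ U) (hF : ContDiffOn ℝ 1 F U) :
    ∃ C : ℝ, ∀ w ∈ Metric.closedBall (0 : ℂ) 1, ‖wdzbar F w‖ ≤ C ∧
      ∀ z ∈ Metric.closedBall (0 : ℂ) 1, ‖F w - F z‖ ≤ C * ‖w - z‖ := by
  obtain ⟨C, hC⟩ := (isCompact_closedBall (0 : ℂ) 1).exists_bound_of_continuousOn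
    ((hF.continuousOn_fderiv_of_isOpen hU le_rfl).mono hUb)
  refine ⟨C, fun w hw => ⟨(norm_wdzbar_le F w).trans (hC w hw), fun z hz => ?_⟩⟩
  exact (convex_closedBall (0 : ℂ) 1).norm_image_sub_le_of_norm_fderiv_le
    (fun x hx => (hF.differentiableOn one_ne_zero).differentiableAt (hU.mem_nhds (hUb hx))) hC hz hw

/-- The **Cauchy–Pompeiu formula** for functions vanishing at the evaluation point. -/
lemma circleIntegral_mul_inv_sub_of_eq_zero {F : ℂ → ℂ} {U : Set ℂ} (hU : IsOpen U)
    (hUb : Metric.closedBall (0 : ℂ) 1 ⊆ U) (hF : ContDiffOn ℝ 1 F U) {z : ℂ}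
    (hz : z ∈ Metric.ball (0 : ℂ) 1) (hFz : F z = 0) :
    (∮ w in C(0, 1), F w * (w - z)⁻¹) =
      2 * I * ∫ w in Metric.ball (0 : ℂ) 1, wdzbar F w * (w - z)⁻¹ := by
  obtain ⟨C, hC⟩ := exists_lipschitz_bound hU hUb hF
  have hzc := Metric.ball_subset_closedBall hz
  have hlip : ∀ w ∈ Metric.closedBall (0 : ℂ) 1, ‖F w‖ ≤ C * ‖w - z‖ := fun w hw => by
    simpa [hFz] using (hC w hw).2 z hzc
  have hC0 : 0 ≤ C := (norm_nonneg _).trans (hC z hzc).1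
  have hreg : ∀ δ : ℝ, 0 < δ → ContDiffOn ℝ 1 (fun w => F w * regKernel z δ w) U := fun δ hδ =>
    hF.mul (contDiff_regKernel z hδ).contDiffOn
  have hwd : ∀ δ : ℝ, 0 < δ → ∀ w ∈ Metric.ball (0 : ℂ) 1,
      wdzbar (fun w => F w * regKernel z δ w) w =
        wdzbar F w * regKernel z δ w + F w * wdzbar (regKernel z δ) w := fun δ hδ w hw =>
    wdzbar_mul ((hF.differentiableOn one_ne_zero).differentiableAt
      (hU.mem_nhds (hUb (Metric.ball_subset_closedBall hw))))
      ((contDiff_regKernel z hδ).differentiable one_ne_zero w)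
  have hcirc : ∀ θ : ℝ, circleMap 0 1 θ ∈ Metric.closedBall (0 : ℂ) 1 := fun θ =>
    circleMap_mem_closedBall 0 zero_le_one θ
  have hleft : Filter.Tendsto (fun δ => ∮ w in C(0, 1), F w * regKernel z δ w)
      (nhdsWithin 0 (Set.Ioi 0)) (nhds (∮ w in C(0, 1), F w * (w - z)⁻¹)) := by
    refine intervalIntegral.tendsto_integral_filter_of_dominated_convergence (fun _ => C)
      ?_ ?_ intervalIntegrable_const ?_
    · filter_upwards [self_mem_nhdsWithin] with δ hδ
      refine Continuous.aestronglyMeasurable ?_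
      have hc : Continuous fun θ => F (circleMap 0 1 θ) * regKernel z δ (circleMap 0 1 θ) :=
        continuousOn_univ.mp ((hreg δ hδ).continuousOn.comp
          (continuous_circleMap 0 1).continuousOn fun θ _ => hUb (hcirc θ))
      simp only [deriv_circleMap]
      exact ((continuous_circleMap 0 1).mul continuous_const).smul hc
    · filter_upwards [self_mem_nhdsWithin] with δ hδ
      refine .of_forall fun θ _ => ?_
      have h1 := hlip _ (hcirc θ)
      have h2 := norm_regKernel_le z (circleMap 0 1 θ) hδ
      have h3 : ‖deriv (circleMap 0 1) θ‖ = 1 := by simp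
      rw [norm_smul, h3, one_mul, norm_mul]
      calc _ ≤ C * ‖circleMap 0 1 θ - z‖ * ‖circleMap 0 1 θ - z‖⁻¹ := by gcongr
        _ ≤ C := by
          rw [mul_assoc]
          exact mul_le_of_le_one_right hC0 mul_inv_le_one
    · exact .of_forall fun θ _ => ((tendsto_regKernel z _).const_mul _).const_smul _
  have hright : Filter.Tendsto
      (fun δ => ∫ w in Metric.ball (0 : ℂ) 1, wdzbar (fun w => F w * regKernel z δ w) w)
      (nhdsWithin 0 (Set.Ioi 0))
      (nhds (∫ w in Metric.ball (0 : ℂ) 1, wdzbar F w * (w - z)⁻¹)) := by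
    refine tendsto_integral_filter_of_dominated_convergence (fun w => 2 * C * ‖w - z‖⁻¹)
      ?_ ?_ ((integrableOn_unitBall_inv_norm_sub z).const_mul (2 * C)) ?_
    · filter_upwards [self_mem_nhdsWithin] with δ hδ
      exact ((continuousOn_wdzbar hU (hreg δ hδ)).mono
        (Metric.ball_subset_closedBall.trans hUb)).aestronglyMeasurable measurableSet_ball
    · filter_upwards [self_mem_nhdsWithin] with δ hδ
      refine ae_restrict_of_forall_mem measurableSet_ball fun w hw => ?_
      have hwc := Metric.ball_subset_closedBall hw
      rw [hwd δ hδ w hw]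
      refine (norm_add_le _ _).trans ?_
      rw [norm_mul, norm_mul, two_mul, add_mul]
      refine add_le_add (mul_le_mul (hC w hwc).1 (norm_regKernel_le z w hδ) (norm_nonneg _) hC0) ?_
      calc _ ≤ C * ‖w - z‖ * ‖wdzbar (regKernel z δ) w‖ := by gcongr; exact hlip w hwc
        _ ≤ _ := by
          rw [mul_assoc]
          gcongr
          exact norm_sub_mul_wdzbar_regKernel_le z w hδ
    · refine ae_restrict_of_forall_mem measurableSet_ball fun w hw => ?_
      have h2 : Filter.Tendsto (fun δ => F w * wdzbar (regKernel z δ) w)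
          (nhdsWithin 0 (Set.Ioi 0)) (nhds 0) := by
        rcases eq_or_ne w z with rfl | h
        · simp [hFz]
        · simpa using (tendsto_wdzbar_regKernel h).const_mul (F w)
      have h1 := ((tendsto_regKernel z w).const_mul (wdzbar F w)).add h2
      rw [add_zero] at h1
      refine h1.congr' ?_
      filter_upwards [self_mem_nhdsWithin] with δ hδ
      exact (hwd δ hδ w hw).symm
  refine tendsto_nhds_unique hleft ((hright.const_mul (2 * I)).congr' ?_)
  filter_upwards [self_mem_nhdsWithin] with δ hδ
  exact (circleIntegral_eq_integral_wdzbar hU hUb (hreg δ hδ)).symm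

/-- The **Cauchy–Pompeiu formula** on the unit disc. -/
lemma circleIntegral_mul_inv_sub {F : ℂ → ℂ} {U : Set ℂ} (hU : IsOpen U)
    (hUb : Metric.closedBall (0 : ℂ) 1 ⊆ U) (hF : ContDiffOn ℝ 1 F U) {z : ℂ}
    (hz : z ∈ Metric.ball (0 : ℂ) 1) :
    (∮ w in C(0, 1), F w * (w - z)⁻¹) =
      2 * Real.pi * I * F z + 2 * I * ∫ w in Metric.ball (0 : ℂ) 1, wdzbar F w * (w - z)⁻¹ := by
  have h := circleIntegral_mul_inv_sub_of_eq_zero hU hUb (hF.sub contDiffOn_const) hz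
    (sub_self (F z))
  have hw : ∀ w, wdzbar (fun w => F w - F z) w = wdzbar F w := fun w => by
    rw [wdzbar, fderiv_sub_const, wdzbar]
  simp only [hw, sub_mul] at h
  have hinv : ContinuousOn (fun w : ℂ => (w - z)⁻¹) (Metric.sphere 0 1) :=
    ContinuousOn.inv₀ (by fun_prop) fun w hw h0 => by
      rw [mem_sphere_zero_iff_norm] at hw
      rw [mem_ball_zero_iff, ← sub_eq_zero.mp h0, hw] at hz
      exact lt_irrefl _ hz
  rw [circleIntegral.integral_sub, circleIntegral.integral_const_mul,
    circleIntegral.integral_sub_inv_of_mem_ball hz] at h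
  · linear_combination h
  · exact ContinuousOn.circleIntegrable zero_le_one
      ((hF.continuousOn.mono (Metric.sphere_subset_closedBall.trans hUb)).mul hinv)
  · exact ContinuousOn.circleIntegrable zero_le_one (continuousOn_const.mul hinv)

lemma contDiff_cexp_phaseR (n : ℝ) (z₀ : ℂ) :
    ContDiff ℝ 1 fun w => exp (-I * n * phaseR w z₀) := by
  unfold phaseR
  exact (contDiff_const.mul (((contDiff_id.sub contDiff_const).pow 2).add
    ((contDiff_conj_sub z₀).pow 2))).cexp

lemma wdzbar_cexp_phaseR (n : ℝ) (z₀ w : ℂ) :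
    wdzbar (fun w => exp (-I * n * phaseR w z₀)) w =
      -2 * I * n * (starRingEnd ℂ (w - z₀)) * exp (-I * n * phaseR w z₀) := by
  have h : HasFDerivAt (fun w => exp (-I * n * phaseR w z₀)) _ w :=
    ((((((hasFDerivAt_id (𝕜 := ℝ) w).sub_const z₀).pow 2).add
      ((hasFDerivAt_conj_sub z₀ w).pow 2))).const_mul (-I * n)).cexp
  rw [wdzbar, h.fderiv]
  simp [phaseR]
  linear_combination (-I * n * (w - z₀ - (starRingEnd ℂ w - starRingEnd ℂ z₀))) *
    exp (-(I * n * ((w - z₀) ^ 2 + (starRingEnd ℂ w - starRingEnd ℂ z₀) ^ 2))) * I_sq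

lemma contDiffOn_div_conj_sub {g : ℂ → ℂ} {U : Set ℂ} (hU : IsOpen U) (hg : ContDiffOn ℝ 1 g U)
    {z₀ : ℂ} (hvan : ∀ᶠ w in nhds z₀, g w = 0) :
    ContDiffOn ℝ 1 (fun w => g w / ((starRingEnd ℂ) w - (starRingEnd ℂ) z₀)) U := by
  intro w hw
  refine ContDiffAt.contDiffWithinAt ?_
  rcases eq_or_ne w z₀ with rfl | h
  · refine (contDiffAt_const (c := (0 : ℂ))).congr_of_eventuallyEq ?_
    filter_upwards [hvan] with x hx
    rw [hx, zero_div]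
  · simp only [← map_sub]
    refine (hg.contDiffAt (hU.mem_nhds hw)).mul ((contDiff_conj_sub z₀).contDiffAt.inv ?_)
    exact (map_ne_zero _).mpr (sub_ne_zero.mpr h)
/-- Integration by parts formula for the Cauchy transform of `e^{-inR} g` when `g` is `C¹`
near the closed unit disc and vanishes near `z₀ ∈ Ω`; the circle `∂Ω` is parametrized by
`t ↦ e^{it}`, `t ∈ [0, 2π]`, so that `dσ = dt`. -/
theorem stmt_9 (n : ℝ) (hn : n ≠ 0) (z₀ : ℂ) (hz₀ : z₀ ∈ Metric.ball (0 : ℂ) 1)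
    (g : ℂ → ℂ)
    (hg : ∃ U : Set ℂ, IsOpen U ∧ Metric.closedBall (0 : ℂ) 1 ⊆ U ∧ ContDiffOn ℝ 1 g U)
    (hvan : ∃ ε : ℝ, 0 < ε ∧ ∀ w ∈ Metric.ball z₀ ε, g w = 0) :
    ∀ᵐ z ∂(volume.restrict (Metric.ball (0 : ℂ) 1)),
      (1 / (Real.pi : ℂ)) * (∫ w in Metric.ball (0 : ℂ) 1,
          Complex.exp (-Complex.I * (n : ℂ) * phaseR w z₀) * g w * (z - w)⁻¹) =
      (-1 / (2 * Complex.I * (n : ℂ))) *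
        (Complex.exp (-Complex.I * (n : ℂ) * phaseR z z₀) * g z /
            ((starRingEnd ℂ) z - (starRingEnd ℂ) z₀)
         - (1 / (Real.pi : ℂ)) * (∫ w in Metric.ball (0 : ℂ) 1,
             Complex.exp (-Complex.I * (n : ℂ) * phaseR w z₀) *
               wdzbar (fun w' => g w' / ((starRingEnd ℂ) w' - (starRingEnd ℂ) z₀)) w *
               (z - w)⁻¹)
         + (1 / (2 * (Real.pi : ℂ))) * ∫ t in (0 : ℝ)..(2 * Real.pi),
             Complex.exp (-Complex.I * (n : ℂ) * phaseR (Complex.exp (Complex.I * (t : ℂ))) z₀) *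
               g (Complex.exp (Complex.I * (t : ℂ))) *
               ((z - Complex.exp (Complex.I * (t : ℂ))) *
                 ((starRingEnd ℂ) (Complex.exp (Complex.I * (t : ℂ))) - (starRingEnd ℂ) z₀))⁻¹ *
               Complex.exp (Complex.I * (t : ℂ))) := by
  obtain ⟨U, hU, hUb, hgU⟩ := hg
  obtain ⟨ε, hε, hvan⟩ := hvan
  refine ae_restrict_of_forall_mem measurableSet_ball fun z hz => ?_
  set h : ℂ → ℂ := fun w => g w / ((starRingEnd ℂ) w - (starRingEnd ℂ) z₀) with hh
  set e : ℂ → ℂ := fun w => exp (-I * n * phaseR w z₀) with he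
  have hhU : ContDiffOn ℝ 1 h U := contDiffOn_div_conj_sub hU hgU
    (Filter.eventually_of_mem (Metric.ball_mem_nhds z₀ hε) hvan)
  have heC : ContDiff ℝ 1 e := contDiff_cexp_phaseR n z₀
  have hgh : ∀ w, (starRingEnd ℂ) (w - z₀) * h w = g w := fun w => by
    rcases eq_or_ne w z₀ with rfl | hw
    · simp [hvan w (Metric.mem_ball_self hε)]
    · have := (map_ne_zero (starRingEnd ℂ)).mpr (sub_ne_zero.mpr hw)
      rw [hh, map_sub] at *
      field_simp
  have hP := circleIntegral_mul_inv_sub hU hUb (heC.contDiffOn.mul hhU) hz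
  have hsplit : ∫ w in Metric.ball (0 : ℂ) 1, wdzbar (fun w => e w * h w) w * (w - z)⁻¹ =
      2 * I * n * (∫ w in Metric.ball (0 : ℂ) 1, e w * g w * (z - w)⁻¹) -
        ∫ w in Metric.ball (0 : ℂ) 1, e w * wdzbar h w * (z - w)⁻¹ := by
    rw [← integral_const_mul, ← integral_sub]
    · refine setIntegral_congr_fun measurableSet_ball fun w hw => ?_
      have hw' := hUb (Metric.ball_subset_closedBall hw)
      rw [wdzbar_mul (heC.differentiable one_ne_zero w)
        ((hhU.differentiableOn one_ne_zero).differentiableAt (hU.mem_nhds hw')), he,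
        wdzbar_cexp_phaseR, ← hgh w, ← neg_sub z w, inv_neg]
      ring
    · exact (integrableOn_mul_inv_sub
        (heC.continuous.continuousOn.mul (hgU.continuousOn.mono hUb)) z).const_mul _
    · exact integrableOn_mul_inv_sub
        (heC.continuous.continuousOn.mul ((continuousOn_wdzbar hU hhU).mono hUb)) z
  have hcirc : (∮ w in C(0, 1), e w * h w * (w - z)⁻¹) =
      -I * ∫ t in (0 : ℝ)..(2 * Real.pi), e (exp (I * t)) * g (exp (I * t)) *
        ((z - exp (I * t)) * ((starRingEnd ℂ) (exp (I * t)) - (starRingEnd ℂ) z₀))⁻¹ *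
          exp (I * t) := by
    rw [circleIntegral, ← intervalIntegral.integral_const_mul]
    refine intervalIntegral.integral_congr fun t _ => ?_
    have hc : circleMap 0 1 t = exp (I * t) := by simp [circleMap, mul_comm]
    simp only [deriv_circleMap, hc, hh, smul_eq_mul]
    rw [← neg_sub z, inv_neg, mul_inv, div_eq_mul_inv]
    ring
  rw [hcirc, hsplit] at hP
  have hpi : (Real.pi : ℂ) ≠ 0 := ofReal_ne_zero.mpr Real.pi_ne_zero
  have hn' : (n : ℂ) ≠ 0 := ofReal_ne_zero.mpr hn
  rw [mul_div_assoc]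
  change _ = _ * (e z * h z - _ + _)
  generalize (∫ w in Metric.ball (0 : ℂ) 1, e w * g w * (z - w)⁻¹) = A at *
  generalize (∫ w in Metric.ball (0 : ℂ) 1, e w * wdzbar h w * (z - w)⁻¹) = B at *
  generalize (∫ t in (0 : ℝ)..(2 * Real.pi), e (exp (I * t)) * g (exp (I * t)) *
        ((z - exp (I * t)) * ((starRingEnd ℂ) (exp (I * t)) - (starRingEnd ℂ) z₀))⁻¹ *
          exp (I * t)) = D at *
  have hI : I ≠ 0 := I_ne_zero
  have hP2 : -D = 2 * Real.pi * (e z * h z) + 2 * (2 * I * n * A - B) := by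
    refine mul_left_cancel₀ hI ?_
    linear_combination hP
  field_simp
  linear_combination -hP2
end
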